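/- arXiv:2201.11832 — 2 statements merged into one kernel-verified Lean document; each statement's English description precedes it below -/
import Mathlib

section
/- (Proposition 1.) Let U : H^{P_O} ⊗ H^{A_O} ⊗ H^{B_O} → H^{F_I} ⊗ H^{A_I} ⊗ H^{B_I} be a unitary extension of a bipartite process. Then: (1) for every choice of finite-dimensional ancilla spaces H^{B_I'}, H^{B_O'} and every unitary U_B : H^{B_I} ⊗ H^{B_I'} → H^{B_O} ⊗ H^{B_O'}, there exist a finite-dimensional space H^E and unitaries ω₁ : H^{B_I'} ⊗ H^{P_O} → H^{A_I} ⊗ H^E and ω₂ : H^{A_O} ⊗ H^E → H^{B_O'} ⊗ H^{F_I} such that |ω₁⟩⟩ * |ω₂⟩⟩ = |U⟩⟩ * |U_B⟩⟩ (the left-hand link product contracting H^E, the right-hand one contracting H^{B_I} and H^{B_O}); and (2) there exist finite-dimensional isomorphic spaces H^Z, H^{Z̄} and unitaries U₁ : H^{A_O} ⊗ H^{P_O} → H^{B_I} ⊗ H^Z and U₂ : H^{B_O} ⊗ H^{Z̄} → H^{A_I} ⊗ H^{F_I} such that |U⟩⟩ = |U₁⟩⟩ * |𝟙⟩⟩^{ZZ̄}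 * |U₂⟩⟩, and moreover, setting J_in := U₁† and J_out := U₂†, the operations of part (1) satisfy |J_in⟩⟩ * (|ω₁⟩⟩ * |ω₂⟩⟩) * |J_out⟩⟩ = |U_B⟩⟩ ⊗ |𝟙⟩⟩^{ZZ̄} (contracting H^{A_O}, H^{P_O}, H^{A_I}, H^{F_I}), i.e. described with respect to the time-delocalised subsystems defined by J_in and J_out, the temporal circuit of part (1) consists of exactly one application of U_B in parallel with an identity channel from Z to Z̄. -/
open Matrix

theorem Matrix.exists_isometry_of_projection {F : Type*} [Fintype F] [DecidableEq F]
    (P : Matrix F F ℂ) (hH : Pᴴ = P) (hP : P * P = P) :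
    ∃ (e : ℕ) (B : Matrix F (Fin e) ℂ), B * Bᴴ = P ∧ Bᴴ * B = 1 := by
  classical
  have hP' : P.IsHermitian := hH
  set μ := hP'.eigenvalues with hμ
  set Q : Matrix F F ℂ := (hP'.eigenvectorUnitary : Matrix F F ℂ) with hQ
  have hQQ : Qᴴ * Q = 1 := Unitary.coe_star_mul_self hP'.eigenvectorUnitary
  have hQQ' : Q * Qᴴ = 1 := Unitary.coe_mul_star_self hP'.eigenvectorUnitary
  have hspec : P = Q * diagonal (fun i => (μ i : ℂ)) * Qᴴ := by
    have := hP'.spectral_theorem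
    rw [Unitary.conjStarAlgAut_apply] at this
    exact this
  have hdiag : diagonal (fun i => (μ i : ℂ)) = Qᴴ * P * Q := by
    rw [hspec]
    simp only [Matrix.mul_assoc, hQQ, Matrix.mul_one]
    rw [← Matrix.mul_assoc, hQQ, Matrix.one_mul]
  have hμμ : ∀ i, μ i = 0 ∨ μ i = 1 := by
    intro i
    have h : diagonal (fun i => (μ i : ℂ)) * diagonal (fun i => (μ i : ℂ))
        = diagonal (fun i => (μ i : ℂ)) := by
      calc _ = Qᴴ * P * (Q * Qᴴ) * P * Q := by rw [hdiag]; simp only [Matrix.mul_assoc]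
        _ = Qᴴ * (P * P) * Q := by rw [hQQ']; simp only [Matrix.mul_assoc, Matrix.one_mul]
        _ = _ := by rw [hP, hdiag]
    rw [diagonal_mul_diagonal] at h
    have h2 := congrFun (diagonal_injective h) i
    have h3 : μ i * μ i = μ i := by exact_mod_cast h2
    rcases eq_or_ne (μ i) 0 with h0 | h0
    · exact Or.inl h0
    · exact Or.inr (mul_left_cancel₀ h0 (by rw [h3, mul_one]))
  let g := (Fintype.equivFin {i // μ i = 1}).symm
  refine ⟨_, Q.submatrix id (fun k => (g k).1), ?_, ?_⟩
  · ext i j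
    rw [hspec, mul_apply, mul_apply]
    simp only [mul_diagonal, conjTranspose_apply, submatrix_apply, id]
    rw [Equiv.sum_comp g (fun k : {i // μ i = 1} => Q i k.1 * star (Q j k.1)),
      ← Finset.sum_subtype (Finset.univ.filter (fun k => μ k = 1)) (by simp)
        (fun k => Q i k * star (Q j k)), Finset.sum_filter]
    refine Finset.sum_congr rfl fun k _ => ?_
    rcases hμμ k with h | h <;> simp [h]
  · have : (Q.submatrix id (fun k => (g k).1))ᴴ * Q.submatrix id (fun k => (g k).1)
        = (Qᴴ * Q).submatrix (fun k => (g k).1) (fun k => (g k).1) := by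
      ext i j; simp [mul_apply]
    rw [this, hQQ]
    exact submatrix_one _ (Subtype.val_injective.comp g.injective)

theorem exists_factorization_of_blocks {F P X Y : Type*} [Fintype F] [DecidableEq F] [Fintype P]
    [DecidableEq P] [Fintype X] [DecidableEq X] [Fintype Y] [DecidableEq Y]
    [Nonempty X] [Nonempty Y]
    (K : X → Y → Matrix F P ℂ)
    (hne : ∀ x x' y y', y ≠ y' → (K x y)ᴴ * K x' y' = 0)
    (heq : ∀ x x' y y', (K x y)ᴴ * K x' y = (K x y')ᴴ * K x' y')
    (hne' : ∀ x x' y y', x ≠ x' → K x y * (K x' y')ᴴ = 0)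
    (heq' : ∀ x x' y y', K x y * (K x y')ᴴ = K x' y * (K x' y')ᴴ)
    (hsum : ∀ y, ∑ x, (K x y)ᴴ * K x y = 1)
    (hsum' : ∀ x, ∑ y, K x y * (K x y)ᴴ = 1) :
    ∃ (e : ℕ) (ω₁ : Matrix (X × Fin e) P ℂ) (ω₂ : Matrix F (Y × Fin e) ℂ),
      ω₁ᴴ * ω₁ = 1 ∧ ω₁ * ω₁ᴴ = 1 ∧ ω₂ᴴ * ω₂ = 1 ∧ ω₂ * ω₂ᴴ = 1 ∧
      ∀ f x p y, K x y f p = ∑ k, ω₁ (x, k) p * ω₂ f (y, k) := by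
  obtain ⟨x₀⟩ := ‹Nonempty X›
  obtain ⟨y₀⟩ := ‹Nonempty Y›
  have hK : ∀ x y, K x y * ((K x y)ᴴ * K x y) = K x y := by
    intro x y
    have h := congrArg (· * K x y) (hsum' x)
    simp only [Matrix.sum_mul, Matrix.one_mul] at h
    rw [Finset.sum_eq_single y, Matrix.mul_assoc] at h
    · exact h
    · intro y' _ hy
      rw [Matrix.mul_assoc, hne x x y' y hy, Matrix.mul_zero]
    · simp
  have hK' : ∀ x y y', K x y * ((K x y')ᴴ * K x y') = K x y := by
    intro x y y'
    rw [heq x x y' y, hK]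
  set p := K x₀ y₀ * (K x₀ y₀)ᴴ with hp
  have hpK : ∀ x, p * K x y₀ = K x y₀ := by
    intro x
    rw [hp, heq' x₀ x, Matrix.mul_assoc, hK]
  have hpK' : ∀ x, (K x y₀)ᴴ * p = (K x y₀)ᴴ := by
    intro x
    have := congrArg conjTranspose (hpK x)
    rwa [conjTranspose_mul, hp, conjTranspose_mul, conjTranspose_conjTranspose, ← hp] at this
  obtain ⟨e, B, hBp, hB⟩ := Matrix.exists_isometry_of_projection p
    (by rw [hp, conjTranspose_mul, conjTranspose_conjTranspose])
    (by conv_lhs => rw [hp, ← Matrix.mul_assoc, ← hp, hpK, ← hp])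
  have hBpB : Bᴴ * p * B = 1 := by
    rw [← hBp, ← Matrix.mul_assoc, hB, Matrix.one_mul, hB]
  set C : X → Matrix (Fin e) P ℂ := fun x => Bᴴ * K x y₀ with hC
  set D : Y → Matrix F (Fin e) ℂ := fun y => K x₀ y * (K x₀ y₀)ᴴ * B with hD
  have hCC : ∑ x, (C x)ᴴ * C x = 1 := by
    rw [← hsum y₀]
    refine Finset.sum_congr rfl fun x _ => ?_
    rw [hC]
    simp only [conjTranspose_mul, conjTranspose_conjTranspose]
    rw [Matrix.mul_assoc, ← Matrix.mul_assoc B, hBp, hpK]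
  have hCC' : ∀ x x', C x * (C x')ᴴ = if x = x' then 1 else 0 := by
    intro x x'
    simp only [hC, conjTranspose_mul, conjTranspose_conjTranspose]
    rw [Matrix.mul_assoc, ← Matrix.mul_assoc (K x y₀)]
    split_ifs with h
    · subst h
      rw [heq' x x₀, ← hp, ← Matrix.mul_assoc, hBpB]
    · rw [hne' _ _ _ _ h, Matrix.zero_mul, Matrix.mul_zero]
  have hDD : ∀ y y', (D y)ᴴ * D y' = if y = y' then 1 else 0 := by
    intro y y'
    have : (D y)ᴴ * D y'
        = Bᴴ * (K x₀ y₀ * ((K x₀ y)ᴴ * K x₀ y') * (K x₀ y₀)ᴴ) * B := by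
      simp only [hD, conjTranspose_mul, conjTranspose_conjTranspose, Matrix.mul_assoc]
    rw [this]
    split_ifs with h
    · subst h
      rw [hK', ← hp, hBpB]
    · rw [hne _ _ _ _ h, Matrix.mul_zero, Matrix.zero_mul, Matrix.mul_zero, Matrix.zero_mul]
  have hDD' : ∑ y, D y * (D y)ᴴ = 1 := by
    rw [← hsum' x₀]
    refine Finset.sum_congr rfl fun y _ => ?_
    calc D y * (D y)ᴴ = K x₀ y * ((K x₀ y₀)ᴴ * (B * Bᴴ)) * K x₀ y₀ * (K x₀ y)ᴴ := by
          simp only [hD, conjTranspose_mul, conjTranspose_conjTranspose, Matrix.mul_assoc]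
      _ = K x₀ y * ((K x₀ y₀)ᴴ * K x₀ y₀) * (K x₀ y)ᴴ := by
          rw [hBp, hpK']; simp only [Matrix.mul_assoc]
      _ = _ := by rw [hK']
  have hDC : ∀ x y, D y * C x = K x y := by
    intro x y
    calc D y * C x = K x₀ y * (K x₀ y₀)ᴴ * (B * Bᴴ * K x y₀) := by
          simp only [hD, hC, Matrix.mul_assoc]
      _ = K x y := by rw [hBp, hpK, heq' x₀ x, Matrix.mul_assoc, hK']
  refine ⟨e, of fun i q => C i.1 i.2 q, of fun f j => D j.1 f j.2, ?_, ?_, ?_, ?_, ?_⟩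
  · ext q q'
    rw [← hCC, Matrix.sum_apply]
    simp [mul_apply, Fintype.sum_prod_type]
  · ext ⟨x, k⟩ ⟨x', k'⟩
    have := congrFun (congrFun (hCC' x x') k) k'
    simp only [mul_apply, conjTranspose_apply] at this ⊢
    simp only [of_apply]
    rw [this]
    by_cases h : x = x' <;> simp [h, one_apply]
  · ext ⟨x, k⟩ ⟨x', k'⟩
    have := congrFun (congrFun (hDD x x') k) k'
    simp only [mul_apply, conjTranspose_apply] at this ⊢
    simp only [of_apply]
    rw [this]
    by_cases h : x = x' <;> simp [h, one_apply]
  · ext q q'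
    rw [← hDD', Matrix.sum_apply]
    simp [mul_apply, Fintype.sum_prod_type]
  · intro f x q y
    rw [← hDC x y, mul_apply]
    simp [mul_comm]

/-- The operation obtained by inserting `M` into the open slot of `W`. -/
def slotLink {F P X Y X' Y' : Type*} [Fintype X] [Fintype Y]
    (W : Matrix (F × X) (P × Y) ℂ) (M : Matrix (Y × Y') (X × X') ℂ) :
    Matrix (F × Y') (P × X') ℂ :=
  of fun i j => ∑ x, ∑ y, W (i.1, x) (j.1, y) * M (y, i.2) (x, j.2)

theorem slotLink_conjTranspose {F P X Y X' Y' : Type*} [Fintype X] [Fintype Y]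
    (W : Matrix (F × X) (P × Y) ℂ) (M : Matrix (Y × Y') (X × X') ℂ) :
    (slotLink W M)ᴴ = slotLink Wᴴ Mᴴ := by
  ext i j
  simp only [slotLink, conjTranspose_apply, of_apply, star_sum, star_mul']
  exact Finset.sum_comm

/-- The identity on `N ⊗ N ⊗ N`, except that `A` acts on the first factor when the other two
are in the maximally entangled state. -/
noncomputable def entangledControl {N : Type*} [Fintype N] [DecidableEq N] (A : Matrix N N ℂ) :
    Matrix (N × (N × N)) (N × (N × N)) ℂ :=
  of fun i j => (if i.1 = j.1 then 1 else 0) * (if i.2.1 = j.2.1 then 1 else 0)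
      * (if i.2.2 = j.2.2 then 1 else 0)
    + (Fintype.card N : ℂ)⁻¹ * (A - 1) i.1 j.1 * (if i.2.1 = i.2.2 then 1 else 0)
      * (if j.2.1 = j.2.2 then 1 else 0)

theorem entangledControl_isometry {N : Type*} [Fintype N] [DecidableEq N] [Nonempty N]
    (A : Matrix N N ℂ) (hA : Aᴴ * A = 1) :
    (entangledControl A)ᴴ * entangledControl A = 1 := by
  have hN : (Fintype.card N : ℂ) ≠ 0 := by simp
  set c : ℂ := (Fintype.card N : ℂ)⁻¹ with hc
  let Q : Matrix (N × N) (N × N) ℂ :=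
    of fun i j => (if i.1 = i.2 then 1 else 0) * (if j.1 = j.2 then 1 else 0)
  have hQ : Qᴴ = Q := by
    ext i j
    simp only [Q, conjTranspose_apply, of_apply, star_mul']
    split_ifs <;> simp
  have hQQ : Q * Q = (Fintype.card N : ℂ) • Q := by
    ext i j
    simp [Q, mul_apply, Fintype.sum_prod_type]
  have hT : entangledControl A = 1 + c • kroneckerMap (· * ·) (A - 1) Q := by
    ext ⟨i, i', i''⟩ ⟨j, j', j''⟩
    simp only [entangledControl, of_apply, Matrix.add_apply, one_apply, Matrix.smul_apply,
      kroneckerMap_apply, Q, Prod.mk.injEq, smul_eq_mul, hc, ite_and, mul_ite, mul_one, mul_zero]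
    congr 1
    split_ifs <;> simp
  have hA' : (Aᴴ - 1) * (A - 1) = -((Aᴴ - 1) + (A - 1)) := by
    rw [Matrix.sub_mul, Matrix.mul_sub, hA]; simp; abel
  have hcc : star c = c := by simp [hc]
  rw [hT, conjTranspose_add, conjTranspose_one, conjTranspose_smul, conjTranspose_kronecker,
    hQ, hcc, conjTranspose_sub, conjTranspose_one, Matrix.add_mul, Matrix.one_mul, Matrix.mul_add,
    Matrix.mul_one, Matrix.smul_mul, Matrix.mul_smul, ← mul_kronecker_mul, hQQ, hA',
    kronecker_smul, smul_smul c (Fintype.card N : ℂ), hc, inv_mul_cancel₀ hN, one_smul]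
  ext i j
  simp only [Matrix.add_apply, Matrix.smul_apply, kroneckerMap_apply, Matrix.neg_apply,
    smul_eq_mul]
  ring

theorem gram_invariant {F P N : Type*} [Fintype F] [DecidableEq F] [Fintype P] [DecidableEq P]
    [Fintype N] [DecidableEq N] [Nonempty N] (W : Matrix (F × N) (P × N) ℂ)
    (hWW : Wᴴ * W = 1)
    (hW : ∀ M : Matrix (N × (N × N)) (N × (N × N)) ℂ, Mᴴ * M = 1 → M * Mᴴ = 1 →
      (slotLink W M)ᴴ * slotLink W M = 1)
    (A : Matrix N N ℂ) (hA : Aᴴ * A = 1) (a b y z : N) (p q : P) :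
    ∑ f, star (∑ s, W (f, a) (p, s) * A s y) * (∑ s, W (f, b) (q, s) * A s z)
      = ∑ f, star (W (f, a) (p, y)) * W (f, b) (q, z) := by
  have hN : (Fintype.card N : ℂ) ≠ 0 := by simp
  set c : ℂ := (Fintype.card N : ℂ)⁻¹ with hc
  have hcc : star c = c := by simp [hc]
  let σ : N × (N × N) ≃ N × (N × N) :=
    ⟨fun j => (j.2.2, (j.1, j.2.1)), fun j => (j.2.1, (j.2.2, j.1)), fun _ => rfl, fun _ => rfl⟩
  set M := (entangledControl A).submatrix id σ with hM
  have hMM : Mᴴ * M = 1 := by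
    rw [hM, conjTranspose_submatrix, ← submatrix_mul _ _ _ _ _ Function.bijective_id,
      entangledControl_isometry A hA, submatrix_one_equiv]
  set D : N → F → P → N → ℂ := fun x f p y => ∑ s, W (f, x) (p, s) * A s y with hD
  have hV : ∀ f u v p x y, slotLink W M (f, (u, v)) (p, (x, y))
      = W (f, u) (p, y) * (if v = x then 1 else 0)
        + c * (if u = v then 1 else 0) * (D x f p y - W (f, x) (p, y)) := by
    intro f u v p x y
    simp only [slotLink, of_apply, hM, submatrix_apply, id, entangledControl, σ, Equiv.coe_fn_mk,
      mul_add, Finset.sum_add_distrib, hD, Matrix.sub_apply, one_apply, ← hc]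
    congr 1
    · simp
    · by_cases huv : u = v
      · simp [huv, mul_sub, Finset.sum_sub_distrib, Finset.mul_sum, mul_left_comm]
        ring
      · simp [huv]
  have h := congrFun (congrFun (hW M hMM (mul_eq_one_comm.mp hMM)) (p, (a, y))) (q, (b, z))
  have h0 := congrFun (congrFun hWW (p, y)) (q, z)
  have hsum : ∀ (g g' : N → ℂ) (d d' : ℂ),
      ∑ u, ∑ v, star (g u * (if v = a then 1 else 0) + c * (if u = v then 1 else 0) * d)
          * (g' u * (if v = b then 1 else 0) + c * (if u = v then 1 else 0) * d')
        = (if a = b then ∑ u, star (g u) * g' u else 0)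
          + c * (star (g a + d) * (g' b + d') - star (g a) * g' b) := by
    intro g g' d d'
    have e : ∀ u v, star (g u * (if v = a then 1 else 0) + c * (if u = v then 1 else 0) * d)
          * (g' u * (if v = b then 1 else 0) + c * (if u = v then 1 else 0) * d')
        = (if v = a then if v = b then star (g u) * g' u else 0 else 0)
          + (if v = a then if u = v then c * (star (g u) * d') else 0 else 0)
          + (if v = b then if u = v then c * (star d * g' u) else 0 else 0)
          + (if u = v then c * c * (star d * d') else 0) := by
      intro u v
      rw [star_add, star_mul', star_mul', star_mul', hcc]
      split_ifs <;> simp <;> ring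
    simp only [e, Finset.sum_add_distrib, Finset.sum_ite_eq', Finset.sum_ite_eq, Finset.mem_univ,
      if_true, Finset.sum_const, Finset.card_univ, nsmul_eq_mul, ← mul_assoc]
    rw [hc, mul_inv_cancel₀ hN, ← hc]
    split_ifs <;> simp only [Finset.sum_const_zero, star_add] <;> ring
  simp only [mul_apply, conjTranspose_apply, Fintype.sum_prod_type, hV] at h h0
  simp only [hsum, Finset.sum_add_distrib, ← Finset.mul_sum, add_sub_cancel,
    Finset.sum_sub_distrib] at h
  have h1 : (∑ f : F, if a = b then ∑ u, star (W (f, u) (p, y)) * W (f, u) (q, z) else 0)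
      = (1 : Matrix (P × (N × N)) (P × (N × N)) ℂ) (p, (a, y)) (q, (b, z)) := by
    by_cases hab : a = b
    · simp only [hab, if_true]
      rw [h0]
      simp [one_apply, hab]
    · simp [hab, one_apply]
  rw [h1, add_eq_left] at h
  exact sub_eq_zero.mp ((mul_eq_zero.mp h).resolve_left (inv_ne_zero hN))

theorem gram_eq_zero_and_eq {F P N : Type*} [Fintype F] [DecidableEq F] [Fintype P]
    [DecidableEq P] [Fintype N] [DecidableEq N] [Nonempty N] (W : Matrix (F × N) (P × N) ℂ)
    (hWW : Wᴴ * W = 1)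
    (hW : ∀ M : Matrix (N × (N × N)) (N × (N × N)) ℂ, Mᴴ * M = 1 → M * Mᴴ = 1 →
      (slotLink W M)ᴴ * slotLink W M = 1) (a b y z : N) (p q : P) :
    (y ≠ z → ∑ f, star (W (f, a) (p, y)) * W (f, b) (q, z) = 0) ∧
      ∑ f, star (W (f, a) (p, y)) * W (f, b) (q, y)
        = ∑ f, star (W (f, a) (p, z)) * W (f, b) (q, z) := by
  constructor
  · intro hyz
    have h := gram_invariant W hWW hW (diagonal fun s => if s = y then -1 else 1)
      (by
        rw [diagonal_conjTranspose, diagonal_mul_diagonal, ← diagonal_one]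
        congr 1
        ext s
        by_cases hs : s = y <;> simp [hs]) a b y z p q
    simp only [diagonal_apply, mul_ite, mul_zero, Finset.sum_ite_eq', Finset.mem_univ, if_true,
      hyz.symm, if_false, mul_one, star_neg, mul_neg, neg_mul, Finset.sum_neg_distrib] at h
    exact self_eq_neg.mp h.symm
  · have h := gram_invariant W hWW hW ((1 : Matrix N N ℂ).submatrix id (Equiv.swap y z))
      (by
        rw [conjTranspose_submatrix, ← submatrix_mul _ _ _ _ _ Function.bijective_id,
          conjTranspose_one, Matrix.one_mul, submatrix_one_equiv]) a b z z p q
    simpa [one_apply] using h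

theorem exists_circuit_of_slotLink {F P N : Type*} [Fintype F] [DecidableEq F] [Fintype P]
    [DecidableEq P] [Fintype N] [DecidableEq N] [Nonempty N] (W : Matrix (F × N) (P × N) ℂ)
    (hWW : Wᴴ * W = 1) (hWW' : W * Wᴴ = 1)
    (hW : ∀ M : Matrix (N × (N × N)) (N × (N × N)) ℂ, Mᴴ * M = 1 → M * Mᴴ = 1 →
      (slotLink W M)ᴴ * slotLink W M = 1 ∧ slotLink W M * (slotLink W M)ᴴ = 1) :
    ∃ (e : ℕ) (ω₁ : Matrix (N × Fin e) P ℂ) (ω₂ : Matrix F (N × Fin e) ℂ),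
      ω₁ᴴ * ω₁ = 1 ∧ ω₁ * ω₁ᴴ = 1 ∧ ω₂ᴴ * ω₂ = 1 ∧ ω₂ * ω₂ᴴ = 1 ∧
      ∀ f x p y, W (f, x) (p, y) = ∑ k, ω₁ (x, k) p * ω₂ f (y, k) := by
  have hcol := gram_eq_zero_and_eq W hWW (fun M hM hM' => (hW M hM hM').1)
  have hrow := gram_eq_zero_and_eq Wᴴ (by rwa [conjTranspose_conjTranspose]) (fun M hM hM' => by
    have h := (hW Mᴴ (by rwa [conjTranspose_conjTranspose])
      (by rwa [conjTranspose_conjTranspose])).2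
    rwa [slotLink_conjTranspose, conjTranspose_conjTranspose,
      ← conjTranspose_conjTranspose (slotLink W Mᴴ), slotLink_conjTranspose,
      conjTranspose_conjTranspose] at h)
  simp only [conjTranspose_apply, star_star] at hrow
  refine exists_factorization_of_blocks (fun x y => of fun f p => W (f, x) (p, y))
    ?_ ?_ ?_ ?_ ?_ ?_
  · intro x x' y y' h
    ext p q
    simpa [mul_apply] using (hcol x x' y y' p q).1 h
  · intro x x' y y'
    ext p q
    simpa [mul_apply] using (hcol x x' y y' p q).2
  · intro x x' y y' h
    ext p q
    simpa [mul_apply] using (hrow y y' x x' p q).1 h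
  · intro x x' y y'
    ext p q
    simpa [mul_apply] using (hrow y y' x x' p q).2
  · intro y
    ext p q
    have := congrFun (congrFun hWW (p, y)) (q, y)
    rw [mul_apply, Fintype.sum_prod_type_right] at this
    simpa [Matrix.sum_apply, mul_apply, one_apply] using this
  · intro x
    ext p q
    have := congrFun (congrFun hWW' (p, x)) (q, x)
    rw [mul_apply, Fintype.sum_prod_type_right] at this
    simpa [Matrix.sum_apply, mul_apply, one_apply] using this

theorem Matrix.submatrix_equiv_unitary {m n m' n' : Type*} [Fintype m] [DecidableEq m]
    [Fintype n] [DecidableEq n] [Fintype m'] [DecidableEq m'] [Fintype n'] [DecidableEq n']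
    (B : Matrix m n ℂ) (e : m' ≃ m) (e' : n' ≃ n) (h : Bᴴ * B = 1) (h' : B * Bᴴ = 1) :
    (B.submatrix e e')ᴴ * B.submatrix e e' = 1 ∧ B.submatrix e e' * (B.submatrix e e')ᴴ = 1 := by
  rw [conjTranspose_submatrix, ← submatrix_mul _ _ _ _ _ e.bijective,
    ← submatrix_mul _ _ _ _ _ e'.bijective, h, h']
  exact ⟨submatrix_one_equiv _, submatrix_one_equiv _⟩

/-- A one-slot map that sends all unitaries, with ancillas, to unitaries is a sequential
circuit of two unitaries around the slot. -/
theorem exists_circuit_of_reversibility {F P X Y : Type*} [Fintype F] [DecidableEq F]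
    [Fintype P] [DecidableEq P] [Fintype X] [DecidableEq X] [Fintype Y] [DecidableEq Y]
    (hXY : Fintype.card X = Fintype.card Y) (W : Matrix (F × X) (P × Y) ℂ)
    (hW : ∀ (X' Y' : Type) [Fintype X'] [DecidableEq X'] [Fintype Y'] [DecidableEq Y'],
      ∀ M : Matrix (Y × Y') (X × X') ℂ, Mᴴ * M = 1 → M * Mᴴ = 1 →
        (slotLink W M)ᴴ * slotLink W M = 1 ∧ slotLink W M * (slotLink W M)ᴴ = 1) :
    ∃ (e : ℕ) (ω₁ : Matrix (X × Fin e) P ℂ) (ω₂ : Matrix F (Y × Fin e) ℂ),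
      ω₁ᴴ * ω₁ = 1 ∧ ω₁ * ω₁ᴴ = 1 ∧ ω₂ᴴ * ω₂ = 1 ∧ ω₂ * ω₂ᴴ = 1 ∧
      ∀ f x p y, W (f, x) (p, y) = ∑ k, ω₁ (x, k) p * ω₂ f (y, k) := by
  obtain hX | hX := isEmpty_or_nonempty X
  · have hY : IsEmpty Y := by
      rw [← Fintype.card_eq_zero_iff, ← hXY, Fintype.card_eq_zero_iff]; exact hX
    obtain ⟨h, h'⟩ := hW Unit Unit 0 (Subsingleton.elim _ _) (Subsingleton.elim _ _)
    have h0 : slotLink W (0 : Matrix (Y × Unit) (X × Unit) ℂ) = 0 := by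
      ext i j
      simp [slotLink]
    have hP : IsEmpty P := ⟨fun p => by
      have := congrFun (congrFun h (p, ())) (p, ())
      simp [h0] at this⟩
    have hF : IsEmpty F := ⟨fun f => by
      have := congrFun (congrFun h' (f, ())) (f, ())
      simp [h0] at this⟩
    exact ⟨0, 0, 0, Subsingleton.elim _ _, Subsingleton.elim _ _, Subsingleton.elim _ _,
      Subsingleton.elim _ _, fun f => hF.elim f⟩
  · obtain ⟨n, hn⟩ : ∃ n, Fintype.card X = n := ⟨_, rfl⟩
    let eX : Fin n ≃ X := (Fintype.equivFinOfCardEq hn).symm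
    let eY : Fin n ≃ Y := (Fintype.equivFinOfCardEq (hXY ▸ hn)).symm
    have : Nonempty (Fin n) := eX.nonempty
    set W' : Matrix (F × Fin n) (P × Fin n) ℂ :=
      W.submatrix ((Equiv.refl F).prodCongr eX) ((Equiv.refl P).prodCongr eY) with hW'
    have hlink : ∀ (X' Y' : Type) [Fintype X'] [DecidableEq X'] [Fintype Y'] [DecidableEq Y'],
        ∀ M : Matrix (Fin n × Y') (Fin n × X') ℂ, Mᴴ * M = 1 → M * Mᴴ = 1 →
        (slotLink W' M)ᴴ * slotLink W' M = 1 ∧ slotLink W' M * (slotLink W' M)ᴴ = 1 := by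
      intro X' Y' _ _ _ _ M hM hM'
      obtain ⟨h₁, h₂⟩ := M.submatrix_equiv_unitary (eY.symm.prodCongr (Equiv.refl Y'))
        (eX.symm.prodCongr (Equiv.refl X')) hM hM'
      have hWM : slotLink W' M = slotLink W (M.submatrix (eY.symm.prodCongr (Equiv.refl Y'))
          (eX.symm.prodCongr (Equiv.refl X'))) := by
        ext i j
        simp only [slotLink, of_apply]
        rw [← Equiv.sum_comp eX]
        refine Finset.sum_congr rfl fun x _ => ?_
        rw [← Equiv.sum_comp eY]
        simp [hW']
      rw [hWM]
      exact hW X' Y' _ h₁ h₂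
    have hswap := (1 : Matrix (Fin n × Fin n) (Fin n × Fin n) ℂ).submatrix_equiv_unitary
      (Equiv.refl _) (Equiv.prodComm _ _) (by simp) (by simp)
    have hid : slotLink W' ((1 : Matrix (Fin n × Fin n) (Fin n × Fin n) ℂ).submatrix
        (Equiv.refl _) (Equiv.prodComm _ _)) = W' := by
      ext ⟨f, x⟩ ⟨p, y⟩
      simp [slotLink, one_apply, ite_and]
    have hWW := hlink _ _ _ hswap.1 hswap.2
    rw [hid] at hWW
    obtain ⟨e, ω₁, ω₂, h₁, h₁', h₂, h₂', h⟩ :=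
      exists_circuit_of_slotLink W' hWW.1 hWW.2 (hlink _ _)
    obtain ⟨k₁, k₁'⟩ := ω₁.submatrix_equiv_unitary (eX.symm.prodCongr (Equiv.refl (Fin e)))
      (Equiv.refl P) h₁ h₁'
    obtain ⟨k₂, k₂'⟩ := ω₂.submatrix_equiv_unitary (Equiv.refl F)
      (eY.symm.prodCongr (Equiv.refl (Fin e))) h₂ h₂'
    refine ⟨e, _, _, k₁, k₁', k₂, k₂', fun f x p y => ?_⟩
    simpa [hW'] using h f (eX.symm x) p (eY.symm y)

theorem sum_star_mul_sum_circuit_mul_star {I O P F B C B' C' Z : Type*} [Fintype I] [Fintype O]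
    [Fintype P] [Fintype F] [Fintype B] [DecidableEq B] [Fintype C] [DecidableEq C]
    [Fintype Z] [DecidableEq Z]
    (U₁ : Matrix (B × Z) (O × P) ℂ) (U₂ : Matrix (I × F) (C × Z) ℂ)
    (h₁ : U₁ * U₁ᴴ = 1) (h₂ : U₂ᴴ * U₂ = 1) (M : Matrix (C × C') (B × B') ℂ)
    (b : B) (z : Z) (b' : B') (c : C) (z' : Z) (c' : C') :
    ∑ o, ∑ p, ∑ i, ∑ f, star (U₁ (b, z) (o, p))
        * (∑ s, ∑ t, (∑ w, U₁ (s, w) (o, p) * U₂ (i, f) (t, w)) * M (t, c') (s, b'))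
        * star (U₂ (i, f) (c, z'))
      = M (c, c') (b, b') * (if z = z' then 1 else 0) := by
  have k₁ : ∀ s w, ∑ j, star (U₁ (b, z) j) * U₁ (s, w) j = if s = b then if w = z then 1 else 0
      else 0 := by
    intro s w
    have := congrFun (congrFun h₁ (s, w)) (b, z)
    rw [mul_apply, one_apply] at this
    simp only [conjTranspose_apply, mul_comm _ (star _), Prod.mk.injEq, ite_and] at this
    exact this
  have k₂ : ∀ t w, ∑ j, U₂ j (t, w) * star (U₂ j (c, z')) = if t = c then if w = z' then 1 else 0
      else 0 := by
    intro t w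
    have := congrFun (congrFun h₂ (c, z')) (t, w)
    rw [mul_apply, one_apply] at this
    simp only [conjTranspose_apply, mul_comm (star _), Prod.mk.injEq, ite_and] at this
    rw [this]
    simp only [eq_comm]
  calc _ = ∑ j : O × P, ∑ l : I × F, ∑ k : B × C × Z,
        star (U₁ (b, z) j) * U₁ (k.1, k.2.2) j * (U₂ l k.2 * star (U₂ l (c, z')))
          * M (k.2.1, c') (k.1, b') := by
        simp only [Fintype.sum_prod_type, Finset.mul_sum, Finset.sum_mul]
        refine Finset.sum_congr rfl fun _ _ => Finset.sum_congr rfl fun _ _ =>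
          Finset.sum_congr rfl fun _ _ => Finset.sum_congr rfl fun _ _ =>
          Finset.sum_congr rfl fun _ _ => Finset.sum_congr rfl fun _ _ =>
          Finset.sum_congr rfl fun _ _ => ?_
        ring
    _ = ∑ k : B × C × Z, (∑ j : O × P, star (U₁ (b, z) j) * U₁ (k.1, k.2.2) j)
          * (∑ l : I × F, U₂ l k.2 * star (U₂ l (c, z'))) * M (k.2.1, c') (k.1, b') := by
        simp only [Finset.sum_mul_sum]
        simp only [Finset.sum_mul]
        rw [Finset.sum_comm (s := (Finset.univ : Finset (B × C × Z)))]
        exact Finset.sum_congr rfl fun j _ => Finset.sum_comm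
    _ = _ := by
        simp only [k₁, k₂, Fintype.sum_prod_type]
        simp [eq_comm (a := z) (b := z')]
/-- Proposition 1. Let
`U : H^{P_O} ⊗ H^{A_O} ⊗ H^{B_O} → H^{F_I} ⊗ H^{A_I} ⊗ H^{B_I}` be a unitary extension of
a bipartite process, i.e. a unitary (with `dim H^{A_I} = dim H^{A_O}`,
`dim H^{B_I} = dim H^{B_O}`) that preserves reversibility: for all finite-dimensional
ancillas and all local unitaries `U_A`, `U_B`, the link `|U⟩⟩ * |U_A⟩⟩ * |U_B⟩⟩`
(contracting `A_I, A_O, B_I, B_O`) is the pure Choi vector of a unitary from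
`H^{P_O} ⊗ H^{A_I'} ⊗ H^{B_I'}` to `H^{F_I} ⊗ H^{A_O'} ⊗ H^{B_O'}`. Then:
(1) for every ancilla choice and every unitary `U_B` there exist `H^E` and unitaries
`ω₁ : H^{B_I'} ⊗ H^{P_O} → H^{A_I} ⊗ H^E`, `ω₂ : H^{A_O} ⊗ H^E → H^{B_O'} ⊗ H^{F_I}` with
`|ω₁⟩⟩ * |ω₂⟩⟩ = |U⟩⟩ * |U_B⟩⟩`; and
(2) there exist `H^Z ≅ H^{Z̄}` and unitaries `U₁ : H^{A_O} ⊗ H^{P_O} → H^{B_I} ⊗ H^Z`,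
`U₂ : H^{B_O} ⊗ H^{Z̄} → H^{A_I} ⊗ H^{F_I}` with `|U⟩⟩ = |U₁⟩⟩ * |𝟙⟩⟩^{ZZ̄} * |U₂⟩⟩`, and
moreover, setting `J_in := U₁†`, `J_out := U₂†`, any operations as in part (1) satisfy
`|J_in⟩⟩ * (|ω₁⟩⟩ * |ω₂⟩⟩) * |J_out⟩⟩ = |U_B⟩⟩ ⊗ |𝟙⟩⟩^{ZZ̄}` (contracting
`H^{A_O}, H^{P_O}, H^{A_I}, H^{F_I}`): with respect to the time-delocalised subsystems
defined by `J_in` and `J_out`, the temporal circuit consists of exactly one application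
of `U_B` in parallel with an identity channel from `Z` to `Z̄`.

Everything is expressed entrywise in fixed computational bases; finite-dimensional
spaces are indexed by types (existential ones by `Fin n`), and maps are matrices with the
output index first. -/
theorem unitary_extension_bipartite_time_delocalised
    {pO aO bO fI aI bI : Type*}
    [Fintype pO] [Fintype aO] [Fintype bO] [Fintype fI] [Fintype aI] [Fintype bI]
    [DecidableEq pO] [DecidableEq aO] [DecidableEq bO] [DecidableEq fI]
    [DecidableEq aI] [DecidableEq bI]
    (hcardA : Fintype.card aI = Fintype.card aO)
    (hcardB : Fintype.card bI = Fintype.card bO)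
    (U : Matrix (fI × aI × bI) (pO × aO × bO) ℂ)
    (hU₁ : Uᴴ * U = 1) (hU₂ : U * Uᴴ = 1)
    (hRev : ∀ (aI' aO' bI' bO' : Type)
      [Fintype aI'] [DecidableEq aI'] [Fintype aO'] [DecidableEq aO']
      [Fintype bI'] [DecidableEq bI'] [Fintype bO'] [DecidableEq bO'],
      ∀ (UA : Matrix (aO × aO') (aI × aI') ℂ) (UB : Matrix (bO × bO') (bI × bI') ℂ),
        UAᴴ * UA = 1 → UA * UAᴴ = 1 → UBᴴ * UB = 1 → UB * UBᴴ = 1 →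
        ∃ V : Matrix (fI × aO' × bO') (pO × aI' × bI') ℂ,
          Vᴴ * V = 1 ∧ V * Vᴴ = 1 ∧
          ∀ (p : pO) (ai' : aI') (bi' : bI') (f : fI) (ao' : aO') (bo' : bO'),
            V (f, ao', bo') (p, ai', bi') =
              ∑ ai : aI, ∑ ao : aO, ∑ bi : bI, ∑ bo : bO,
                U (f, ai, bi) (p, ao, bo) * UA (ao, ao') (ai, ai')
                  * UB (bo, bo') (bi, bi')) :
    -- Part (1): a temporal circuit for every fixed local operation of Bob.
    (∀ (bI' bO' : Type)
      [Fintype bI'] [DecidableEq bI'] [Fintype bO'] [DecidableEq bO'],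
      ∀ (UB : Matrix (bO × bO') (bI × bI') ℂ), UBᴴ * UB = 1 → UB * UBᴴ = 1 →
        ∃ (e : ℕ) (ω₁ : Matrix (aI × Fin e) (bI' × pO) ℂ)
          (ω₂ : Matrix (bO' × fI) (aO × Fin e) ℂ),
          ω₁ᴴ * ω₁ = 1 ∧ ω₁ * ω₁ᴴ = 1 ∧ ω₂ᴴ * ω₂ = 1 ∧ ω₂ * ω₂ᴴ = 1 ∧
          ∀ (bi' : bI') (p : pO) (ai : aI) (ao : aO) (bo' : bO') (f : fI),
            (∑ e' : Fin e, ω₁ (ai, e') (bi', p) * ω₂ (bo', f) (ao, e')) =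
              ∑ bi : bI, ∑ bo : bO,
                U (f, ai, bi) (p, ao, bo) * UB (bo, bo') (bi, bi'))
    ∧
    -- Part (2): the time-delocalised subsystems.
    (∃ (nz : ℕ) (U₁ : Matrix (bI × Fin nz) (aO × pO) ℂ)
        (U₂ : Matrix (aI × fI) (bO × Fin nz) ℂ),
        U₁ᴴ * U₁ = 1 ∧ U₁ * U₁ᴴ = 1 ∧ U₂ᴴ * U₂ = 1 ∧ U₂ * U₂ᴴ = 1 ∧
        (∀ (f : fI) (ai : aI) (bi : bI) (p : pO) (ao : aO) (bo : bO),
          U (f, ai, bi) (p, ao, bo) =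
            ∑ z : Fin nz, U₁ (bi, z) (ao, p) * U₂ (ai, f) (bo, z)) ∧
        (∀ (bI' bO' : Type)
          [Fintype bI'] [DecidableEq bI'] [Fintype bO'] [DecidableEq bO'],
          ∀ (UB : Matrix (bO × bO') (bI × bI') ℂ), UBᴴ * UB = 1 → UB * UBᴴ = 1 →
          ∀ (E : Type) [Fintype E],
          ∀ (ω₁ : Matrix (aI × E) (bI' × pO) ℂ) (ω₂ : Matrix (bO' × fI) (aO × E) ℂ),
            (∀ (bi' : bI') (p : pO) (ai : aI) (ao : aO) (bo' : bO') (f : fI),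
              (∑ e' : E, ω₁ (ai, e') (bi', p) * ω₂ (bo', f) (ao, e')) =
                ∑ bi : bI, ∑ bo : bO,
                  U (f, ai, bi) (p, ao, bo) * UB (bo, bo') (bi, bi')) →
            ∀ (bi : bI) (z : Fin nz) (bi' : bI') (bo : bO) (z' : Fin nz) (bo' : bO'),
              (∑ ao : aO, ∑ p : pO, ∑ ai : aI, ∑ f : fI,
                  star (U₁ (bi, z) (ao, p))
                    * (∑ e' : E, ω₁ (ai, e') (bi', p) * ω₂ (bo', f) (ao, e'))
                    * star (U₂ (ai, f) (bo, z')))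
                = UB (bo, bo') (bi, bi') * (if z = z' then 1 else 0))) := by
  refine ⟨?_, ?_⟩
  · intro bI' bO' _ _ _ _ UB hB hB'
    let W : Matrix ((fI × bO') × aI) ((pO × bI') × aO) ℂ := of fun i j =>
      ∑ bi, ∑ bo, U (i.1.1, i.2, bi) (j.1.1, j.2, bo) * UB (bo, i.1.2) (bi, j.1.2)
    obtain ⟨e, ω₁, ω₂, h₁, h₁', h₂, h₂', h⟩ := exists_circuit_of_reversibility hcardA W (by
      intro aI' aO' _ _ _ _ M hM hM'
      obtain ⟨V, hV, hV', hVU⟩ := hRev aI' aO' bI' bO' M UB hM hM' hB hB'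
      let e : (fI × bO') × aO' ≃ fI × aO' × bO' :=
        ⟨fun i => (i.1.1, i.2, i.1.2), fun i => ((i.1, i.2.2), i.2.1), fun _ => rfl, fun _ => rfl⟩
      let e' : (pO × bI') × aI' ≃ pO × aI' × bI' :=
        ⟨fun i => (i.1.1, i.2, i.1.2), fun i => ((i.1, i.2.2), i.2.1), fun _ => rfl, fun _ => rfl⟩
      have hlink : slotLink W M = V.submatrix e e' := by
        ext i j
        rw [submatrix_apply]
        refine Eq.trans ?_ (hVU _ _ _ _ _ _).symm
        refine Finset.sum_congr rfl fun x _ => Finset.sum_congr rfl fun y _ => ?_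
        simp only [W, of_apply, Finset.sum_mul, mul_right_comm]
      rw [hlink]
      exact V.submatrix_equiv_unitary e e' hV hV')
    obtain ⟨k₁, k₁'⟩ := ω₁.submatrix_equiv_unitary (Equiv.refl _) (Equiv.prodComm _ _) h₁ h₁'
    obtain ⟨k₂, k₂'⟩ := ω₂.submatrix_equiv_unitary (Equiv.prodComm _ _) (Equiv.refl _) h₂ h₂'
    exact ⟨e, _, _, k₁, k₁', k₂, k₂', fun bi' p ai ao bo' f => (h (f, bo') ai (p, bi') ao).symm⟩
  · let W : Matrix ((fI × aI) × bI) ((pO × aO) × bO) ℂ := of fun i j =>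
      U (i.1.1, i.1.2, i.2) (j.1.1, j.1.2, j.2)
    obtain ⟨e, ω₁, ω₂, h₁, h₁', h₂, h₂', h⟩ := exists_circuit_of_reversibility hcardB W (by
      intro bI' bO' _ _ _ _ M hM hM'
      let eI := Fintype.equivFin aI
      let eO := Fintype.equivFin aO
      let g : aO × Fin (Fintype.card aI) ≃ aI × Fin (Fintype.card aO) :=
        ⟨fun i => (eI.symm i.2, eO i.1), fun i => (eO.symm i.2, eI i.1),
          fun _ => by simp, fun _ => by simp⟩
      obtain ⟨hA, hA'⟩ := (1 : Matrix (aI × Fin (Fintype.card aO)) (aI × Fin (Fintype.card aO))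
        ℂ).submatrix_equiv_unitary g (Equiv.refl _) (by simp) (by simp)
      obtain ⟨V, hV, hV', hVU⟩ := hRev _ _ bI' bO' _ M hA hA' hM hM'
      let e : (fI × aI) × bO' ≃ fI × Fin (Fintype.card aI) × bO' :=
        ⟨fun i => (i.1.1, eI i.1.2, i.2), fun i => ((i.1, eI.symm i.2.1), i.2.2),
          fun _ => by simp, fun _ => by simp⟩
      let e' : (pO × aO) × bI' ≃ pO × Fin (Fintype.card aO) × bI' :=
        ⟨fun i => (i.1.1, eO i.1.2, i.2), fun i => ((i.1, eO.symm i.2.1), i.2.2),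
          fun _ => by simp, fun _ => by simp⟩
      have hlink : slotLink W M = V.submatrix e e' := by
        ext ⟨⟨f, ai⟩, bo'⟩ ⟨⟨p, ao⟩, bi'⟩
        rw [submatrix_apply]
        refine Eq.trans ?_ (hVU _ _ _ _ _ _).symm
        rw [Finset.sum_eq_single ai (fun x _ hx => by simp [g, one_apply, hx.symm]) (by simp),
          Finset.sum_eq_single ao (fun x _ hx => by simp [g, one_apply, hx]) (by simp)]
        refine Finset.sum_congr rfl fun x _ => Finset.sum_congr rfl fun y _ => ?_
        simp [g, W, one_apply]
      rw [hlink]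
      exact V.submatrix_equiv_unitary e e' hV hV')
    obtain ⟨k₁, k₁'⟩ := ω₁.submatrix_equiv_unitary (Equiv.refl _) (Equiv.prodComm _ _) h₁ h₁'
    obtain ⟨k₂, k₂'⟩ := ω₂.submatrix_equiv_unitary (Equiv.prodComm _ _) (Equiv.refl _) h₂ h₂'
    have hU : ∀ f ai bi p ao bo, U (f, ai, bi) (p, ao, bo) = _ :=
      fun f ai bi p ao bo => h (f, ai) bi (p, ao) bo
    refine ⟨e, _, _, k₁, k₁', k₂, k₂', hU, ?_⟩
    intro bI' bO' _ _ _ _ UB _ _ E _ ω₁' ω₂' hω bi z bi' bo z' bo'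
    refine Eq.trans ?_ (sum_star_mul_sum_circuit_mul_star _ _ k₁' k₂ UB bi z bi' bo z' bo')
    refine Finset.sum_congr rfl fun ao _ => Finset.sum_congr rfl fun p _ =>
      Finset.sum_congr rfl fun ai _ => Finset.sum_congr rfl fun f _ => ?_
    refine congrArg (_ * · * _) ((hω bi' p ai ao bo' f).trans ?_)
    exact Finset.sum_congr rfl fun s _ => Finset.sum_congr rfl fun t _ =>
      congrArg (· * _) (hU f ai s p ao t)
end

section
/- (Proposition 2.) Let U : H^{P_O} ⊗ H^{A_O} ⊗ H^{B_O} ⊗ H^{C_O} → H^{F_I} ⊗ H^{A_I} ⊗ H^{B_I} ⊗ H^{C_I} be a unitary extension of a tripartite process, with dim H^{X_I} = dim H^{X_O} = d for X = A, B, C. Then for every choice of finite-dimensional ancilla spaces H^{C_I'}, H^{C_O'} and every unitary U_C : H^{C_I} ⊗ H^{C_I'} → H^{C_O} ⊗ H^{C_O'} there exist: finite-dimensional spaces H^{E₁}, H^{E₂}; d-dimensional target spaces H^{T₁}, H^{T₁'}, H^{T₂}, H^{T₂'} and isomorphic copies H^{T̄₁}, H^{T̄₁'}, H^{T̄₂},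 H^{T̄₂'}; two-dimensional control spaces H^{Q₁}, H^{Q̄₁}, H^{Q₂'}, H^{Q̄₂'} and two-dimensional spaces H^p, H^f, H^Y ≅ H^{Ȳ}; isomorphic spaces H^Z ≅ H^{Z̄}; unitaries ω₁(U_C) : H^p ⊗ H^{C_I'} ⊗ H^{P_O} → H^{T̄₁} ⊗ H^{E₁} ⊗ H^{Q̄₁}, ω₂°(U_C), ω₂•(U_C) : H^{T̄₁'} ⊗ H^{E₁} → H^{T̄₂} ⊗ H^{E₂}, and ω₃(U_C) : H^{T̄₂'} ⊗ H^{E₂} ⊗ H^{Q̄₂'} → H^f ⊗ H^{C_O'} ⊗ H^{F_I}; and unitary isomorphisms J_in : H^{A_I} ⊗ H^{B_I} ⊗ H^{C_I} ⊗ H^Y ⊗ H^Z → H^{T₁} ⊗ H^{T₂} ⊗ H^{T̄₁'} ⊗ H^{T̄₂'} ⊗ H^{Q₁} ⊗ H^{P_O} and J_out : H^{T₁'} ⊗ H^{T₂'} ⊗ H^{T̄₁} ⊗ H^{T̄₂} ⊗ H^{Q₂'} ⊗ H^{F_I} → H^{A_O} ⊗ H^{B_O} ⊗ H^{C_O} ⊗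 H^{Ȳ} ⊗ H^{Z̄}; such that, for all unitaries U_A : H^{A_I} ⊗ H^{A_I'} → H^{A_O} ⊗ H^{A_O'} and U_B : H^{B_I} ⊗ H^{B_I'} → H^{B_O} ⊗ H^{B_O'}, denoting by |Φ₁(U_A,U_B,U_C)⟩⟩ the pure Choi vector of the temporal circuit fragment consisting of ω₁(U_C) with |0⟩ prepared on H^p, the coherently controlled applications of U_A and U_B on targets T₁/T₂ conditioned on the control qubits, the controlled application of ω₂°(U_C)/ω₂•(U_C), and ω₃(U_C) with H^f projected onto |0⟩ (Eq. (C21) of the paper), one has |J_in⟩⟩ * |Φ₁(U_A,U_B,U_C)⟩⟩ * |J_out⟩⟩ = |U_A⟩⟩ ⊗ |U_B⟩⟩ ⊗ |R(U_C)⟩⟩ for a linear map R(U_C) : H^{C_I'} ⊗ H^{C_I} ⊗ H^Y ⊗ H^Z ⊗ H^{Q̄₂'} → H^{C_O'} ⊗ H^{C_O} ⊗ H^{Ȳ} ⊗ H^{Z̄} ⊗ H^{Q̄₁}, which moreover satisfies |R(U_C)⟩⟩ * |R'⟩⟩ = |U⟩⟩ * |U_C⟩⟩ (link product contracting C_I,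 C_O on the right), where R' is the operation obtained by composing J_out† and J_in† with the identity channels relating the barred and unbarred target and control systems (Eq. (C24) of the paper). In particular, with respect to the time-delocalised subsystems defined by J_in and J_out, the temporal circuit consists of U_A, U_B, U_C and U composed in a cyclic circuit as in the process matrix framework. -/
open Matrix

/-- First coherently controlled gate of the tripartite temporal circuit: on control
value `0` it applies `U_A` to the target and Alice's ancilla (identically transmitting
Bob's ancilla), and on control value `1` it applies `U_B` to the target and Bob's
ancilla (identically transmitting Alice's ancilla). Index order: target, Alice ancilla,
Bob ancilla, control. -/
noncomputable def gate1 {d : ℕ} {A' B' : Type*} [DecidableEq A'] [DecidableEq B']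
    (UA : Matrix (Fin d × A') (Fin d × A') ℂ)
    (UB : Matrix (Fin d × B') (Fin d × B') ℂ) :
    Matrix (Fin d × A' × B' × Fin 2) (Fin d × A' × B' × Fin 2) ℂ :=
  fun o i =>
    if i.2.2.2 = 0 ∧ o.2.2.2 = 0 then
      UA (o.1, o.2.1) (i.1, i.2.1) * (if o.2.2.1 = i.2.2.1 then 1 else 0)
    else if i.2.2.2 = 1 ∧ o.2.2.2 = 1 then
      UB (o.1, o.2.2.1) (i.1, i.2.2.1) * (if o.2.1 = i.2.1 then 1 else 0)
    else 0

/-- Second coherently controlled gate of the tripartite temporal circuit: on control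
value `0` it applies `U_B`, and on control value `1` it applies `U_A`. -/
noncomputable def gate2 {d : ℕ} {A' B' : Type*} [DecidableEq A'] [DecidableEq B']
    (UA : Matrix (Fin d × A') (Fin d × A') ℂ)
    (UB : Matrix (Fin d × B') (Fin d × B') ℂ) :
    Matrix (Fin d × A' × B' × Fin 2) (Fin d × A' × B' × Fin 2) ℂ :=
  fun o i =>
    if i.2.2.2 = 0 ∧ o.2.2.2 = 0 then
      UB (o.1, o.2.2.1) (i.1, i.2.2.1) * (if o.2.1 = i.2.1 then 1 else 0)
    else if i.2.2.2 = 1 ∧ o.2.2.2 = 1 then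
      UA (o.1, o.2.1) (i.1, i.2.1) * (if o.2.2.1 = i.2.2.1 then 1 else 0)
    else 0

/-- The pure Choi vector `|Φ₁(U_A,U_B,U_C)⟩⟩` of the temporal circuit fragment of
Eq. (C21): `ω₁(U_C)` with `|0⟩` prepared on `H^p`, the coherently controlled application
of `U_A`/`U_B` on the first target, the controlled application of
`ω₂°(U_C)`/`ω₂•(U_C)`, the second coherently controlled application of `U_B`/`U_A`, and
`ω₃(U_C)` with `H^f` projected onto `|0⟩`. The internal wires `E₁`, `E₂`, the ancilla
wires `α`, `β` between the two controlled gates, and the control wires `Q₁' , Q₂` are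
contracted. The free incoming indices are
`ci' : C_I'`, `p : P_O`, `t1 : T₁`, `t2 : T₂`, `tb1' : T̄₁'`, `tb2' : T̄₂'`, `q1 : Q₁`,
`qb2' : Q̄₂'`, `ai' : A_I'`, `bi' : B_I'`; the free outgoing indices are
`tb1 : T̄₁`, `tb2 : T̄₂`, `t1' : T₁'`, `t2' : T₂'`, `qb1 : Q̄₁`, `q2' : Q₂'`,
`co' : C_O'`, `f : F_I`, `ao' : A_O'`, `bo' : B_O'`. -/
noncomputable def Phi1 {d : ℕ} {pO fI cI' cO' A' B' E₁ E₂ : Type*}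
    [Fintype E₁] [Fintype E₂] [Fintype A'] [Fintype B'] [DecidableEq A'] [DecidableEq B']
    (ω₁ : Matrix (Fin d × E₁ × Fin 2) (Fin 2 × cI' × pO) ℂ)
    (ω₂c ω₂b : Matrix (Fin d × E₂) (Fin d × E₁) ℂ)
    (ω₃ : Matrix (Fin 2 × cO' × fI) (Fin d × E₂ × Fin 2) ℂ)
    (UA : Matrix (Fin d × A') (Fin d × A') ℂ)
    (UB : Matrix (Fin d × B') (Fin d × B') ℂ)
    (ci' : cI') (p : pO) (t1 t2 tb1' tb2' : Fin d) (q1 qb2' : Fin 2)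
    (ai' : A') (bi' : B')
    (tb1 tb2 t1' t2' : Fin d) (qb1 q2' : Fin 2) (co' : cO') (f : fI)
    (ao' : A') (bo' : B') : ℂ :=
  ∑ e1 : E₁, ∑ e2 : E₂, ∑ q1' : Fin 2, ∑ q2 : Fin 2, ∑ am : A', ∑ bm : B',
    ω₁ (tb1, e1, qb1) (0, ci', p)
      * gate1 UA UB (t1', am, bm, q1') (t1, ai', bi', q1)
      * (if q1' = 0 ∧ q2 = 0 then ω₂c (tb2, e2) (tb1', e1)
         else if q1' = 1 ∧ q2 = 1 then ω₂b (tb2, e2) (tb1', e1) else 0)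
      * gate2 UA UB (t2', ao', bo', q2') (t2, am, bm, q2)
      * ω₃ (0, co', f) (tb2', e2, qb2')

theorem exists_unitary_diagonalization {n : Type*} [Fintype n] [DecidableEq n]
    {L : Matrix n n ℂ} (hL : Lᴴ = L) :
    ∃ (V : Matrix n n ℂ) (D : n → ℝ), Vᴴ * V = 1 ∧ V * Vᴴ = 1 ∧
      L = V * diagonal (fun i => (D i : ℂ)) * Vᴴ := by
  have h : L.IsHermitian := hL
  refine ⟨h.eigenvectorUnitary, h.eigenvalues, ?_, ?_, ?_⟩
  · exact Unitary.coe_star_mul_self h.eigenvectorUnitary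
  · exact Unitary.coe_mul_star_self h.eigenvectorUnitary
  · conv_lhs => rw [h.spectral_theorem, Unitary.conjStarAlgAut_apply]
    rfl

/-- The projection onto the kernel of a Hermitian matrix. -/
theorem exists_kernel_projection {n : Type*} [Fintype n] [DecidableEq n]
    {L : Matrix n n ℂ} (hL : Lᴴ = L) :
    ∃ π L' : Matrix n n ℂ, π * π = π ∧ πᴴ = π ∧ L * π = 0 ∧ 1 - π = L * L' := by
  obtain ⟨V, D, h₁, h₂, rfl⟩ := exists_unitary_diagonalization hL
  have key : ∀ a b : n → ℂ, V * diagonal a * Vᴴ * (V * diagonal b * Vᴴ)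
      = V * diagonal (fun i => a i * b i) * Vᴴ := fun a b => by
    calc _ = V * diagonal a * (Vᴴ * V) * diagonal b * Vᴴ := by simp only [Matrix.mul_assoc]
      _ = _ := by rw [h₁, Matrix.mul_one, Matrix.mul_assoc V, diagonal_mul_diagonal]
  refine ⟨V * diagonal (fun i => if D i = 0 then 1 else 0) * Vᴴ,
    V * diagonal (fun i => ((D i)⁻¹ : ℂ)) * Vᴴ, ?_, ?_, ?_, ?_⟩
  · rw [key]
    congr 3
    ext i
    by_cases h : D i = 0 <;> simp [h]
  · simp only [conjTranspose_mul, conjTranspose_conjTranspose, diagonal_conjTranspose,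
      ← Matrix.mul_assoc]
    congr 3
    ext i
    by_cases h : D i = 0 <;> simp [h]
  · rw [key]
    have : (fun i => (D i : ℂ) * (if D i = 0 then 1 else 0)) = 0 := by
      ext i
      by_cases h : D i = 0 <;> simp [h]
    rw [this, Pi.zero_def, diagonal_zero]
    simp
  · have h1 : (1 : Matrix n n ℂ) = V * diagonal (fun _ => 1) * Vᴴ := by simp [h₂]
    rw [key]
    conv_lhs => rw [h1]
    rw [← Matrix.sub_mul, ← Matrix.mul_sub, diagonal_sub]
    congr 3
    ext i
    by_cases h : D i = 0 <;> simp [h]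

/-- Every projection is `S * Sᴴ` for an isometry `S`. -/
theorem exists_isometry_of_projection {n : Type*} [Fintype n] [DecidableEq n]
    {e : Matrix n n ℂ} (he : e * e = e) (he' : eᴴ = e) :
    ∃ (m : ℕ) (S : Matrix n (Fin m) ℂ), Sᴴ * S = 1 ∧ S * Sᴴ = e := by
  obtain ⟨V, D, h₁, h₂, hV⟩ := exists_unitary_diagonalization he'
  have hD : ∀ i, D i = 0 ∨ D i = 1 := by
    have hd : Vᴴ * e * V = diagonal (fun i => (D i : ℂ)) := by
      rw [hV]
      calc _ = (Vᴴ * V) * diagonal (fun i => (D i : ℂ)) * (Vᴴ * V) := by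
            simp only [Matrix.mul_assoc]
        _ = _ := by simp [h₁]
    have hdd : diagonal (fun i => (D i : ℂ)) * diagonal (fun i => (D i : ℂ))
        = diagonal (fun i => (D i : ℂ)) := by
      rw [← hd]
      calc _ = Vᴴ * e * (V * Vᴴ) * e * V := by simp only [Matrix.mul_assoc]
        _ = _ := by rw [h₂, Matrix.mul_one, Matrix.mul_assoc Vᴴ, he]
    intro i
    have := congrFun (congrFun hdd i) i
    simp only [diagonal_mul_diagonal, diagonal_apply_eq] at this
    have h : D i * D i = D i := by exact_mod_cast this
    rcases eq_or_ne (D i) 0 with h0 | h0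
    · exact Or.inl h0
    · exact Or.inr (mul_left_cancel₀ h0 (by rw [h, mul_one]))
  let eq := (Fintype.equivFin {i // D i = 1}).symm
  refine ⟨_, V.submatrix id (fun k => (eq k).1), ?_, ?_⟩
  · have : (V.submatrix id (fun k => (eq k).1))ᴴ * V.submatrix id (fun k => (eq k).1)
        = (Vᴴ * V).submatrix (fun k => (eq k).1) (fun k => (eq k).1) := by
      ext; simp [Matrix.mul_apply]
    rw [this, h₁, submatrix_one (fun k => (eq k).1) (Subtype.val_injective.comp eq.injective)]
  · rw [hV]
    ext i j
    simp only [Matrix.mul_apply, submatrix_apply, id, conjTranspose_apply, diagonal_apply,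
      mul_ite, mul_zero, Finset.sum_ite_eq', Finset.mem_univ, if_true]
    calc _ = ∑ k : {k // D k = 1}, V i k.1 * star (V j k.1) :=
          eq.sum_comp (fun k => V i k.1 * star (V j k.1))
      _ = ∑ k with D k = 1, V i k * star (V j k) :=
          (Finset.sum_subtype _ (by simp) (fun k => V i k * star (V j k))).symm
      _ = _ := by
          rw [Finset.sum_filter]
          refine Finset.sum_congr rfl fun k _ => ?_
          rcases hD k with h | h <;> simp [h]

/-- Every isometry extends to a unitary. -/
theorem exists_unitary_extension {m n k : Type*} [Fintype m] [DecidableEq m] [Fintype n]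
    [DecidableEq n] [Fintype k] [DecidableEq k]
    (hcard : Fintype.card m = Fintype.card n + Fintype.card k)
    {J : Matrix m n ℂ} (hJ : Jᴴ * J = 1) :
    ∃ J' : Matrix m k ℂ, (fromCols J J')ᴴ * fromCols J J' = 1 ∧
      fromCols J J' * (fromCols J J')ᴴ = 1 := by
  obtain ⟨r, S, hS₁, hS₂⟩ := exists_isometry_of_projection (e := 1 - J * Jᴴ)
    (by
      have : J * Jᴴ * (J * Jᴴ) = J * Jᴴ := by
        rw [Matrix.mul_assoc, ← Matrix.mul_assoc Jᴴ, hJ, Matrix.one_mul]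
      simp [Matrix.mul_sub, Matrix.sub_mul, this])
    (by simp)
  have hr : r = Fintype.card k := by
    have h1 := congrArg trace hS₂
    rw [trace_mul_comm, hS₁, trace_sub, trace_mul_comm, hJ] at h1
    simp only [trace_one, hcard, Fintype.card_fin, Nat.cast_add] at h1
    have h2 : (r : ℂ) = (Fintype.card k : ℂ) := by rw [h1]; ring
    exact_mod_cast h2
  let q : k ≃ Fin r := Fintype.equivFinOfCardEq hr.symm
  have hrow : fromCols J (S.submatrix id q) * (fromCols J (S.submatrix id q))ᴴ = 1 := by
    rw [conjTranspose_fromCols_eq_fromRows_conjTranspose, fromCols_mul_fromRows,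
      conjTranspose_submatrix, submatrix_mul_equiv, hS₂]
    simp
  refine ⟨S.submatrix id q, ?_, hrow⟩
  exact (mul_eq_one_comm_of_card_eq _ _ _ (by simpa using hcard)).1 hrow

/-- The complex linear span of the projections contains every matrix. -/
theorem matrix_induction_on_projections {n : Type*} [Fintype n] [DecidableEq n]
    {p : Matrix n n ℂ → Prop} (hadd : ∀ X Y, p X → p Y → p (X + Y))
    (hsmul : ∀ (c : ℂ) X, p X → p (c • X)) (hproj : ∀ Q, Q * Q = Q → Qᴴ = Q → p Q)
    (X : Matrix n n ℂ) : p X := by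
  have herm : ∀ X : Matrix n n ℂ, Xᴴ = X → p X := by
    intro X hX
    obtain ⟨V, D, h₁, h₂, rfl⟩ := exists_unitary_diagonalization hX
    have : V * diagonal (fun i => (D i : ℂ)) * Vᴴ
        = ∑ i, (D i : ℂ) • (V * single i i 1 * Vᴴ) := by
      rw [← sum_single_eq_diagonal, Matrix.mul_sum, Matrix.sum_mul]
      refine Finset.sum_congr rfl fun i _ => ?_
      rw [← Matrix.smul_mul, ← Matrix.mul_smul, smul_single, smul_eq_mul, mul_one]
    rw [this]
    refine Finset.sum_induction _ p hadd ?_ fun i _ => hsmul _ _ (hproj _ ?_ ?_)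
    · simpa using hproj 0 (by simp) (by simp)
    · calc _ = V * single i i 1 * (Vᴴ * V) * single i i 1 * Vᴴ := by
            simp only [Matrix.mul_assoc]
        _ = _ := by rw [h₁, Matrix.mul_one, Matrix.mul_assoc V, single_mul_single_same, mul_one]
    · simp [conjTranspose_mul, Matrix.mul_assoc]
  have : X = (1 / 2 : ℂ) • (X + Xᴴ) + (-Complex.I / 2) • (Complex.I • (X - Xᴴ)) := by
    rw [smul_smul, show -Complex.I / 2 * Complex.I = 1 / 2 by
      rw [div_mul_eq_mul_div, neg_mul, Complex.I_mul_I, neg_neg], ← smul_add,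
      add_add_sub_cancel, ← two_smul ℂ X, smul_smul]
    norm_num
  rw [this]
  exact hadd _ _ (hsmul _ _ (herm _ (by simp [add_comm])))
    (hsmul _ _ (herm _ (by simp [← smul_neg])))

open scoped ComplexOrder in
/-- The projection onto the common kernel of a set of matrices. -/
theorem exists_common_kernel_projection {n : Type*} [Fintype n] [DecidableEq n]
    (N : Set (Matrix n n ℂ)) :
    ∃ π : Matrix n n ℂ, π * π = π ∧ πᴴ = π ∧ (∀ l ∈ N, l * π = 0) ∧
      ∀ B : Matrix n n ℂ, (∀ l ∈ N, B * lᴴ = 0) → B * (1 - π) = 0 := by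
  obtain ⟨t, htN, ht⟩ := (Submodule.fg_span_iff_fg_span_finset_subset (R := ℂ) N).1
    (IsNoetherian.noetherian _)
  obtain ⟨π, L', h₁, h₂, h₃, h₄⟩ := exists_kernel_projection (L := ∑ l ∈ t, lᴴ * l)
    (by simp [conjTranspose_sum])
  refine ⟨π, h₁, h₂, ?_, ?_⟩
  · have ht0 : ∀ l ∈ t, l * π = 0 := by
      have h0 : ∑ l ∈ t, trace ((l * π)ᴴ * (l * π)) = 0 := by
        calc _ = trace (πᴴ * ((∑ l ∈ t, lᴴ * l) * π)) := by
              rw [← trace_sum, Matrix.sum_mul, Matrix.mul_sum]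
              simp only [conjTranspose_mul, Matrix.mul_assoc]
          _ = 0 := by simp [h₃]
      intro l hl
      exact trace_conjTranspose_mul_self_eq_zero_iff.1 ((Finset.sum_eq_zero_iff_of_nonneg
        fun l _ => (posSemidef_conjTranspose_mul_self (l * π)).trace_nonneg).1 h0 l hl)
    intro l hl
    have hl' : l ∈ Submodule.span ℂ (t : Set (Matrix n n ℂ)) := ht ▸ Submodule.subset_span hl
    clear hl
    induction hl' using Submodule.span_induction with
    | mem x hx => exact ht0 x hx
    | zero => simp
    | add x y _ _ hx hy => simp_all [Matrix.add_mul]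
    | smul c x _ hx => simp_all
  · intro B hB
    rw [h₄, ← Matrix.mul_assoc, Matrix.mul_sum, Finset.sum_eq_zero, Matrix.zero_mul]
    intro l hl
    rw [← Matrix.mul_assoc, hB l (htN hl), Matrix.zero_mul]

/-- A matrix that intertwines an action of the matrix units on its input with the matrix
units of an output factor is, up to an isometric change of the input, the identity on
that factor tensored with an isometry. -/
theorem exists_tensor_factor {d : ℕ} [NeZero d] {F N K O : Type*} [Fintype F] [Fintype N]
    [DecidableEq N] [Fintype K] [DecidableEq O] [Nonempty O]
    {W : Fin d → K → O → Matrix F N ℂ} {π : Matrix N N ℂ}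
    (hiso : ∀ o o', ∑ i, ∑ k, (W i k o)ᴴ * W i k o' = if o = o' then π else 0)
    (hW : ∀ i k o, W i k o * π = W i k o)
    {b : Fin d → Fin d → Matrix N N ℂ} (hb : ∀ i j, π * b i j = b i j)
    (hWb : ∀ i j i' k o, W i' k o * b i j = if i' = i then W j k o else 0) :
    ∃ (m : ℕ) (S : Fin d → Matrix N (Fin m) ℂ),
      (∀ i j, (S i)ᴴ * S j = if i = j then 1 else 0) ∧ ∑ i, S i * (S i)ᴴ = π ∧
      (∀ i k o, W 0 k o * S 0 * (S i)ᴴ = W i k o) ∧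
      ∀ o o', ∑ k, (W 0 k o * S 0)ᴴ * (W 0 k o' * S 0) = if o = o' then 1 else 0 := by
  obtain ⟨o₀⟩ := ‹Nonempty O›
  have hb₁ : ∀ i j, b i j = ∑ k, (W i k o₀)ᴴ * W j k o₀ := by
    intro i j
    calc b i j = (∑ i', ∑ k, (W i' k o₀)ᴴ * W i' k o₀) * b i j := by
          rw [hiso, if_pos rfl, hb]
      _ = ∑ k, (W i k o₀)ᴴ * W j k o₀ := by
          simp only [Matrix.sum_mul, Matrix.mul_assoc, hWb]
          rw [Finset.sum_eq_single i] <;> simp +contextual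
  have hstar : ∀ i j, (b i j)ᴴ = b j i := by
    intro i j
    simp [hb₁, conjTranspose_sum]
  have hbb : ∀ i j k l, b i j * b k l = if j = k then b i l else 0 := by
    intro i j k l
    rw [hb₁ i j, Matrix.sum_mul]
    simp only [Matrix.mul_assoc, hWb]
    split_ifs with h
    · rw [hb₁ i l]
    · simp
  have hsum : ∑ i, b i i = π := by
    simp only [hb₁, hiso, if_true]
  obtain ⟨m, S₀, h₁, h₂⟩ := exists_isometry_of_projection (e := b 0 0) (by simp [hbb]) (hstar 0 0)
  have hS₀ : b 0 0 * S₀ = S₀ := by rw [← h₂, Matrix.mul_assoc, h₁, Matrix.mul_one]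
  have hSS : ∀ i j, (b i 0 * S₀)ᴴ * (b j 0 * S₀) = if i = j then 1 else 0 := by
    intro i j
    rw [conjTranspose_mul, hstar, Matrix.mul_assoc, ← Matrix.mul_assoc (b 0 i), hbb]
    split_ifs with h
    · rw [hS₀, h₁]
    · simp
  have hπ : ∑ i, b i 0 * S₀ * (b i 0 * S₀)ᴴ = π := by
    rw [← hsum]
    refine Finset.sum_congr rfl fun i _ => ?_
    rw [conjTranspose_mul, hstar, Matrix.mul_assoc, ← Matrix.mul_assoc S₀, h₂, hbb, if_pos rfl,
      hbb, if_pos rfl]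
  have hWS : ∀ i k o j, W i k o * (b j 0 * S₀) = if i = j then W 0 k o * S₀ else 0 := by
    intro i k o j
    rw [← Matrix.mul_assoc, hWb]
    split_ifs <;> simp
  refine ⟨m, fun i => b i 0 * S₀, hSS, hπ, ?_, ?_⟩
  · intro i k o
    rw [hWS, if_pos rfl, ← hW i, ← hπ, Matrix.mul_sum, Finset.sum_eq_single i]
    · rw [← Matrix.mul_assoc (W i k o), hWS, if_pos rfl]
    · intro j _ hj
      rw [← Matrix.mul_assoc (W i k o), hWS, if_neg hj.symm, Matrix.zero_mul]
    · simp
  · intro o o'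
    simp only [hWS, if_true]
    have h3 : ∑ i, ∑ k, (W i k o)ᴴ * W i k o' * S₀ = ∑ k, (W 0 k o)ᴴ * (W 0 k o' * S₀) := by
      rw [Finset.sum_eq_single 0]
      · simp only [Matrix.mul_assoc]
      · intro i _ hi
        refine Finset.sum_eq_zero fun k _ => ?_
        have := hWS i k o' 0
        rw [hS₀, if_neg hi] at this
        rw [Matrix.mul_assoc, this, Matrix.mul_zero]
      · simp
    have hπS : π * S₀ = S₀ := by rw [← hS₀, ← Matrix.mul_assoc, hb]
    simp only [← Matrix.sum_mul, hiso] at h3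
    simp only [conjTranspose_mul, Matrix.mul_assoc]
    rw [← Matrix.mul_sum, ← h3]
    split_ifs
    · rw [hπS, h₁]
    · simp

/-- If the first output factor is generated by the input space `P` alone and the second one
by `P` together with the first input factor, then `W` is a circuit with fixed order. -/
theorem exists_fixed_order_circuit {d : ℕ} [NeZero d] {F P : Type*} [Fintype F] [Fintype P]
    [DecidableEq P] {W : Fin d → Fin d → Fin d → Fin d → Matrix F P ℂ} {π : Matrix P P ℂ}
    (hiso : ∀ a' b' a'' b'', ∑ a, ∑ b, (W a b a' b')ᴴ * W a b a'' b'' =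
      if a' = a'' ∧ b' = b'' then π else 0)
    (hW : ∀ a b a' b', W a b a' b' * π = W a b a' b')
    (hA : ∀ i j, ∃ c : Matrix P P ℂ, π * c = c ∧
      ∀ a b a' b', W a b a' b' * c = if a = i then W j b a' b' else 0)
    (hB : ∀ i j, ∃ c : Fin d → Fin d → Matrix P P ℂ,
      ∀ a b a' b', ∑ a'', W a b a'' b' * c a'' a' = if b = i then W a j a' b' else 0) :
    ∃ (m : ℕ) (S : Fin d → Matrix P (Fin m) ℂ) (R : Matrix (Fin d × Fin m) (Fin d × Fin m) ℂ)
      (Z : Fin d → Matrix F (Fin m) ℂ),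
      (∀ i j, (S i)ᴴ * S j = if i = j then 1 else 0) ∧ ∑ i, S i * (S i)ᴴ = π ∧
      Rᴴ * R = 1 ∧ R * Rᴴ = 1 ∧
      (∑ a', ∑ b', W 0 0 a' b' * (W 0 0 a' b')ᴴ = ∑ b', Z b' * (Z b')ᴴ) ∧
      ∀ a b a' b', W a b a' b' =
        Z b' * R.submatrix (fun y => (b, y)) (fun x => (a', x)) * (S a)ᴴ := by
  choose c hc₁ hc₂ using hA
  choose e he using hB
  obtain ⟨m, S, hS₁, hS₂, hS₃, hS₄⟩ := exists_tensor_factor (O := Fin d × Fin d)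
    (W := fun a b o => W a b o.1 o.2) (π := π) (b := c)
    (by rintro ⟨a', b'⟩ ⟨a'', b''⟩; simpa using hiso a' b' a'' b'')
    (fun a b o => hW a b o.1 o.2) hc₁ (fun i j a b o => hc₂ i j a b o.1 o.2)
  obtain ⟨m', T, hT₁, hT₂, hT₃, hT₄⟩ := exists_tensor_factor (O := Fin d) (K := Unit)
    (N := Fin m × Fin d) (π := 1)
    (W := fun b _ b' => of fun f xa => (W 0 b xa.2 b' * S 0) f xa.1)
    (b := fun i j => of fun x y => ((S 0)ᴴ * e i j x.2 y.2 * S 0) x.1 y.1)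
    (by
      intro b' b''
      ext ⟨x, a⟩ ⟨y, a'⟩
      have := congrFun (congrFun (hS₄ (a, b') (a', b'')) x) y
      simp only [Matrix.sum_apply] at this
      simp only [Finset.univ_unique, Finset.sum_singleton, Matrix.sum_apply]
      refine Eq.trans ?_ (this.trans ?_)
      · rfl
      · by_cases h : b' = b'' <;> by_cases h' : a = a' <;> by_cases h'' : x = y <;>
          simp [h, h', h'', Matrix.one_apply])
    (fun _ _ _ => Matrix.mul_one _) (fun _ _ => Matrix.one_mul _)
    (by
      intro i j b _ b'
      ext f ⟨y, a'⟩
      have h1 : ∀ a'', W 0 b a'' b' * S 0 * ((S 0)ᴴ * e i j a'' a' * S 0)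
          = W 0 b a'' b' * e i j a'' a' * S 0 := by
        intro a''
        conv_rhs => rw [← hS₃ 0 b (a'', b')]
        simp only [Matrix.mul_assoc]
      have h2 : ∑ a'', W 0 b a'' b' * S 0 * ((S 0)ᴴ * e i j a'' a' * S 0)
          = if b = i then W 0 j a' b' * S 0 else 0 := by
        simp only [h1, ← Matrix.sum_mul, he]
        split_ifs <;> simp
      have h3 := congrFun (congrFun h2 f) y
      simp only [Matrix.sum_apply] at h3
      rw [Matrix.mul_apply, Fintype.sum_prod_type, Finset.sum_comm]
      refine Eq.trans ?_ (h3.trans ?_)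
      · rfl
      · split_ifs <;> rfl)
  have hm : m' = m := by
    have h1 := congrArg trace hT₂
    simp only [trace_sum, trace_mul_comm (T _), hT₁, if_true, trace_one, Fintype.card_fin,
      Fintype.card_prod, Finset.sum_const, Finset.card_univ, nsmul_eq_mul] at h1
    have h2 : d * m' = m * d := by exact_mod_cast h1
    rw [mul_comm m] at h2
    exact Nat.eq_of_mul_eq_mul_left (Nat.pos_of_neZero d) h2
  subst hm
  let R : Matrix (Fin d × Fin m') (Fin d × Fin m') ℂ :=
    of fun by' ax => star (T by'.1 (ax.2, ax.1) by'.2)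
  have hR : R * Rᴴ = 1 := by
    ext ⟨b, y⟩ ⟨b', y'⟩
    have := congrFun (congrFun (hT₁ b b') y) y'
    rw [Matrix.mul_apply, Fintype.sum_prod_type] at this
    rw [Matrix.mul_apply, Fintype.sum_prod_type, Finset.sum_comm]
    refine Eq.trans ?_ (this.trans ?_)
    · simp [R]
    · by_cases h : b = b' <;> by_cases h' : y = y' <;> simp [h, h', Matrix.one_apply]
  let Z : Fin d → Matrix F (Fin m') ℂ := fun b' =>
    (of fun f xa => (W 0 0 xa.2 b' * S 0) f xa.1 : Matrix F (Fin m' × Fin d) ℂ) * T 0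
  have hWZ : ∀ a b a' b', W a b a' b' =
      Z b' * R.submatrix (fun y => (b, y)) (fun x => (a', x)) * (S a)ᴴ := by
    intro a b a' b'
    have h1 : W 0 b a' b' * S 0 = Z b' * R.submatrix (fun y => (b, y)) (fun x => (a', x)) := by
      ext f x
      exact (congrFun (congrFun (hT₃ b () b') f) (x, a')).symm
    rw [← h1]
    exact (hS₃ a b (a', b')).symm
  refine ⟨m', S, R, Z, hS₁, hS₂, mul_eq_one_comm.1 hR, hR, ?_, hWZ⟩
  have hRR : ∑ a' : Fin d, R.submatrix (fun y => (0, y)) (fun x => (a', x)) *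
      (R.submatrix (fun y => (0, y)) (fun x => (a', x)))ᴴ = (1 : Matrix (Fin m') (Fin m') ℂ) := by
    ext y y'
    have := congrFun (congrFun hR (0, y)) (0, y')
    rw [Matrix.mul_apply, Fintype.sum_prod_type] at this
    simp only [Matrix.sum_apply, Matrix.mul_apply]
    refine this.trans ?_
    simp [Matrix.one_apply]
  rw [Finset.sum_comm]
  refine Finset.sum_congr rfl fun b' _ => ?_
  have h1 : ∀ a', W 0 0 a' b' * (W 0 0 a' b')ᴴ = Z b' *
      (R.submatrix (fun y => (0, y)) (fun x => (a', x)) *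
      (R.submatrix (fun y => (0, y)) (fun x => (a', x)))ᴴ) * (Z b')ᴴ := by
    intro a'
    rw [hWZ 0 0 a' b']
    simp only [conjTranspose_mul, conjTranspose_conjTranspose]
    rw [Matrix.mul_assoc _ (S 0)ᴴ, ← Matrix.mul_assoc (S 0)ᴴ, hS₁, if_pos rfl, Matrix.one_mul]
    simp only [Matrix.mul_assoc]
  simp only [h1, ← Matrix.mul_sum, ← Matrix.sum_mul, hRR, Matrix.mul_one]

theorem commute_of_controlled_unitary {R : Type*} [Ring R] [StarRing R] {q S : R}
    (hq : q * q = q) (hq' : star q = q) (hS' : S * star S = 1)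
    (h : star (q * S + (1 - q)) * (q * S + (1 - q)) = 1) : q * S = S * q := by
  have h1 : star (q * S + (1 - q)) * (q * S + (1 - q)) = star S * q * S + (1 - q) := by
    simp only [star_add, star_mul, star_sub, star_one, hq']
    calc _ = star S * (q * q) * S + star S * (q - q * q) + (q - q * q) * S
          + (1 - q - (q - q * q)) := by noncomm_ring
      _ = _ := by rw [hq]; noncomm_ring
  have h2 : star S * q * S = q := by
    rw [h1] at h
    exact (eq_sub_of_add_eq h).trans (by abel)
  calc q * S = (S * star S) * q * S := by rw [hS', one_mul]
    _ = S * (star S * q * S) := by noncomm_ring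
    _ = S * q := by rw [h2]

theorem commutator_mul_commutator_eq_zero {R : Type*} [Ring R] [StarRing R] {q r S T : R}
    (hq : q * q = q) (hq' : star q = q) (hr : r * r = r) (hr' : star r = r)
    (hqr : q * r = r * q) (hS : star S * S = 1) (hS' : S * star S = 1)
    (hT' : T * star T = 1) (hST : S * T = T * S)
    (hqS : q * S = S * q) (hrT : r * T = T * r)
    (h : star (q * r * (S * T) + q * (1 - r) * S + (1 - q) * r * T + (1 - q) * (1 - r)) *
      (q * r * (S * T) + q * (1 - r) * S + (1 - q) * r * T + (1 - q) * (1 - r)) = 1) :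
    (q * T - T * q) * (r * S - S * r) = 0 := by
  have hqS' : q * star S = star S * q := by
    have := congrArg star hqS
    simp only [star_mul, hq'] at this
    exact this.symm
  have hTS' : T * star S = star S * T := by
    calc T * star S = star S * (S * T) * star S := by rw [← mul_assoc, hS, one_mul]
      _ = star S * T * (S * star S) := by rw [hST]; noncomm_ring
      _ = star S * T := by rw [hS', mul_one]
  set g : R := q * S + (1 - q) with hg
  have hgg : star g * g = 1 := by
    simp only [hg, star_add, star_mul, star_sub, star_one, hq']
    calc _ = star S * (q * q) * S + star S * (q - q * q) + (q - q * q) * S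
          + (1 - q - (q - q * q)) := by noncomm_ring
      _ = star S * (q * S) + (1 - q) := by rw [hq]; noncomm_ring
      _ = _ := by rw [hqS, ← mul_assoc, hS]; noncomm_ring
  have hG : q * r * (S * T) + q * (1 - r) * S + (1 - q) * r * T + (1 - q) * (1 - r)
      = r * (g * T) + (1 - r) * g := by
    have hqr' : q * (1 - r) = (1 - r) * q := by rw [mul_sub, sub_mul, hqr]; simp
    have h1 : (1 - q) * r = r * (1 - q) := by rw [mul_sub, sub_mul, hqr]; simp
    have h2 : (1 - q) * (1 - r) = (1 - r) * (1 - q) := by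
      simp only [mul_sub, sub_mul, hqr, one_mul, mul_one]; abel
    rw [hqr, hqr', h1, h2, hg]
    noncomm_ring
  have h1 : star T * (star g * r * g) * T = star g * r * g := by
    rw [hG] at h
    have h2 : star (r * (g * T) + (1 - r) * g) * (r * (g * T) + (1 - r) * g)
        = star T * (star g * r * g) * T + star g * g - star g * r * g := by
      simp only [star_add, star_mul, star_sub, star_one, hr']
      calc _ = star T * star g * (r * r) * g * T + star T * star g * (r - r * r) * g
            + star g * (r - r * r) * g * T + star g * (1 - r - (r - r * r)) * g := by
              noncomm_ring
        _ = _ := by rw [hr]; noncomm_ring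
    rw [h2, hgg, sub_eq_iff_eq_add, add_comm] at h
    exact add_left_cancel h
  set δ : R := star S * r * S - r with hδ
  have h3 : star g * r * g = r + q * δ := by
    simp only [hg, star_add, star_mul, star_sub, star_one, hq']
    calc _ = star S * q * r * (q * S) + star S * (q * r) * (1 - q) + (1 - q) * r * (q * S)
          + (1 - q) * r * (1 - q) := by noncomm_ring
      _ = star S * q * r * (S * q) + star S * (r * (q - q * q)) + (q * r - q * q * r) * S
          + (1 - q) * r * (1 - q) := by rw [hqS, hqr, ← hqS, mul_assoc q q r, hqr]; noncomm_ring
      _ = q * star S * r * (q * S) + (1 - q) * (r - q * r) := by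
          rw [hq, sub_self, sub_self, ← hqS', ← hqS, hqr]; noncomm_ring
      _ = star S * (q * (r * q)) * S + (r - q * r) - (q * r - q * q * r) := by
          rw [hqS']; noncomm_ring
      _ = star S * (q * q) * r * S + (r - q * r) := by
          rw [← hqr, ← mul_assoc q q r, hq]; noncomm_ring
      _ = q * star S * r * S + (r - q * r) := by rw [hq, hqS']
      _ = _ := by rw [hδ]; noncomm_ring
  have h4 : T * (q * δ) = q * δ * T := by
    have : T * (star g * r * g) = star g * r * g * T := by
      conv_lhs => rw [← h1]
      calc _ = (T * star T) * (star g * r * g) * T := by noncomm_ring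
        _ = _ := by rw [hT', one_mul]
    rw [h3, mul_add, add_mul, hrT] at this
    exact add_left_cancel this
  have h5 : T * δ = δ * T := by
    rw [hδ]
    calc _ = T * star S * r * S - T * r := by noncomm_ring
      _ = star S * (T * r) * S - T * r := by rw [hTS']; noncomm_ring
      _ = star S * r * (T * S) - r * T := by rw [← hrT]; noncomm_ring
      _ = _ := by rw [← hST]; noncomm_ring
  have h6 : (q * T - T * q) * δ = 0 := by
    rw [sub_mul, mul_assoc q, h5, mul_assoc T, h4]
    noncomm_ring
  have hSδ : S * δ = r * S - S * r := by
    rw [hδ, mul_sub, ← mul_assoc, ← mul_assoc, hS', one_mul]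
  rw [← hSδ, ← mul_assoc, sub_mul, mul_assoc q, ← hST, mul_assoc T, hqS, ← mul_assoc, hqS,
    ← mul_assoc T, ← hST, mul_assoc S, mul_assoc S, ← mul_sub, mul_assoc, h6, mul_zero]

/-- The operator acting as `X` on the second tensor factor. -/
noncomputable def actA {P D : Type*} [DecidableEq P] [DecidableEq D] (X : Matrix D D ℂ) :
    Matrix (P × D × D) (P × D × D) ℂ :=
  kroneckerMap (· * ·) (1 : Matrix P P ℂ) (kroneckerMap (· * ·) X (1 : Matrix D D ℂ))

/-- The operator acting as `X` on the third tensor factor. -/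
noncomputable def actB {P D : Type*} [DecidableEq P] [DecidableEq D] (X : Matrix D D ℂ) :
    Matrix (P × D × D) (P × D × D) ℂ :=
  kroneckerMap (· * ·) (1 : Matrix P P ℂ) (kroneckerMap (· * ·) (1 : Matrix D D ℂ) X)

section action

variable {P D : Type*} [DecidableEq P] [DecidableEq D]

@[simp] theorem actA_one : actA (P := P) (1 : Matrix D D ℂ) = 1 := by simp [actA]

@[simp] theorem actB_one : actB (P := P) (1 : Matrix D D ℂ) = 1 := by simp [actB]

theorem actA_add (X Y : Matrix D D ℂ) : actA (P := P) (X + Y) = actA X + actA Y := by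
  simp [actA, add_kronecker, kronecker_add]

theorem actB_add (X Y : Matrix D D ℂ) : actB (P := P) (X + Y) = actB X + actB Y := by
  simp [actB, kronecker_add]

theorem actA_smul (c : ℂ) (X : Matrix D D ℂ) : actA (P := P) (c • X) = c • actA X := by
  simp [actA, smul_kronecker, kronecker_smul]

theorem actB_smul (c : ℂ) (X : Matrix D D ℂ) : actB (P := P) (c • X) = c • actB X := by
  simp [actB, kronecker_smul]

theorem conjTranspose_actA (X : Matrix D D ℂ) : (actA (P := P) X)ᴴ = actA Xᴴ := by
  simp [actA, conjTranspose_kronecker]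

theorem conjTranspose_actB (X : Matrix D D ℂ) : (actB (P := P) X)ᴴ = actB Xᴴ := by
  simp [actB, conjTranspose_kronecker]

variable [Fintype P] [Fintype D]

theorem actA_mul (X Y : Matrix D D ℂ) : actA (P := P) X * actA Y = actA (X * Y) := by
  simp [actA, ← mul_kronecker_mul]

theorem actB_mul (X Y : Matrix D D ℂ) : actB (P := P) X * actB Y = actB (X * Y) := by
  simp [actB, ← mul_kronecker_mul]

theorem actA_mul_actB (X Y : Matrix D D ℂ) : actA (P := P) X * actB Y = actB Y * actA X := by
  simp [actA, actB, ← mul_kronecker_mul]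

end action

/-- The operator resulting from inserting into `W` Alice's operation controlled by `Q`
with target operation `S`, and Bob's operation controlled by `Q'` with target operation `T`. -/
noncomputable def controlledLoop {F P D : Type*} [Fintype F] [DecidableEq F] [Fintype P]
    [DecidableEq P] [Fintype D] [DecidableEq D] (W : Matrix (F × D × D) (P × D × D) ℂ)
    (Q Q' S T : Matrix D D ℂ) : Matrix (F × D × D) (P × D × D) ℂ :=
  actA (P := F) Q * actB (P := F) Q' * W * (actA (P := P) S * actB (P := P) T)
    + actA (P := F) Q * actB (P := F) (1 - Q') * W * actA (P := P) S
    + actA (P := F) (1 - Q) * actB (P := F) Q' * W * actB (P := P) T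
    + actA (P := F) (1 - Q) * actB (P := F) (1 - Q') * W

/-- The operator `1 ⊗ X ⊗ 1` on the outputs of `W`, pulled back to the inputs. -/
noncomputable def pullA {F P D : Type*} [Fintype F] [DecidableEq F]
    [Fintype D] [DecidableEq D] (W : Matrix (F × D × D) (P × D × D) ℂ) (X : Matrix D D ℂ) :
    Matrix (P × D × D) (P × D × D) ℂ :=
  Wᴴ * actA (P := F) X * W

/-- The operator `1 ⊗ 1 ⊗ X` on the outputs of `W`, pulled back to the inputs. -/
noncomputable def pullB {F P D : Type*} [Fintype F] [DecidableEq F]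
    [Fintype D] [DecidableEq D] (W : Matrix (F × D × D) (P × D × D) ℂ) (X : Matrix D D ℂ) :
    Matrix (P × D × D) (P × D × D) ℂ :=
  Wᴴ * actB (P := F) X * W

theorem reflection_unitary {n : Type*} [Fintype n] [DecidableEq n] {Q : Matrix n n ℂ}
    (hQ : Q * Q = Q) (hQ' : Qᴴ = Q) :
    (1 - (2 : ℂ) • Q)ᴴ * (1 - (2 : ℂ) • Q) = 1 ∧
      (1 - (2 : ℂ) • Q) * (1 - (2 : ℂ) • Q)ᴴ = 1 := by
  have h : (1 - (2 : ℂ) • Q)ᴴ = 1 - (2 : ℂ) • Q := by simp [hQ']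
  have h' : (1 - (2 : ℂ) • Q) * (1 - (2 : ℂ) • Q) = 1 := by
    simp only [Matrix.sub_mul, Matrix.mul_sub, Matrix.mul_one, Matrix.one_mul, smul_mul_smul,
      hQ]
    module
  rw [h]
  exact ⟨h', h'⟩

section pullback

variable {F P D : Type*} [Fintype F] [DecidableEq F] [Fintype P] [DecidableEq P] [Fintype D]
  [DecidableEq D] {W : Matrix (F × D × D) (P × D × D) ℂ}

theorem conjTranspose_pullA (X : Matrix D D ℂ) : (pullA W X)ᴴ = pullA W Xᴴ := by
  simp only [pullA, conjTranspose_mul, conjTranspose_conjTranspose, conjTranspose_actA,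
    Matrix.mul_assoc]

theorem conjTranspose_pullB (X : Matrix D D ℂ) : (pullB W X)ᴴ = pullB W Xᴴ := by
  simp only [pullB, conjTranspose_mul, conjTranspose_conjTranspose, conjTranspose_actB,
    Matrix.mul_assoc]

theorem pullA_add (X Y : Matrix D D ℂ) : pullA W (X + Y) = pullA W X + pullA W Y := by
  simp only [pullA, actA_add, Matrix.mul_add, Matrix.add_mul]

theorem pullB_add (X Y : Matrix D D ℂ) : pullB W (X + Y) = pullB W X + pullB W Y := by
  simp only [pullB, actB_add, Matrix.mul_add, Matrix.add_mul]

theorem pullA_smul (c : ℂ) (X : Matrix D D ℂ) : pullA W (c • X) = c • pullA W X := by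
  simp [pullA, actA_smul]

theorem pullB_smul (c : ℂ) (X : Matrix D D ℂ) : pullB W (c • X) = c • pullB W X := by
  simp [pullB, actB_smul]

theorem pullback_mul (hW : W * Wᴴ = 1) (X Y : Matrix (F × D × D) (F × D × D) ℂ) :
    Wᴴ * X * W * (Wᴴ * Y * W) = Wᴴ * (X * Y) * W := by
  calc _ = Wᴴ * X * (W * Wᴴ) * Y * W := by simp only [Matrix.mul_assoc]
    _ = _ := by rw [hW, Matrix.mul_one]; simp only [Matrix.mul_assoc]

theorem pullA_mul (hW : W * Wᴴ = 1) (X Y : Matrix D D ℂ) :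
    pullA W X * pullA W Y = pullA W (X * Y) := by
  simp only [pullA, pullback_mul hW, actA_mul]

theorem pullB_mul (hW : W * Wᴴ = 1) (X Y : Matrix D D ℂ) :
    pullB W X * pullB W Y = pullB W (X * Y) := by
  simp only [pullB, pullback_mul hW, actB_mul]

theorem pullA_mul_pullB (hW : W * Wᴴ = 1) (X Y : Matrix D D ℂ) :
    pullA W X * pullB W Y = pullB W Y * pullA W X := by
  simp only [pullA, pullB, pullback_mul hW, actA_mul_actB]

theorem mul_pullA (hW : W * Wᴴ = 1) (X : Matrix D D ℂ) : W * pullA W X = actA (P := F) X * W := by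
  rw [pullA, ← Matrix.mul_assoc, ← Matrix.mul_assoc, hW, Matrix.one_mul]

theorem mul_pullB (hW : W * Wᴴ = 1) (X : Matrix D D ℂ) : W * pullB W X = actB (P := F) X * W := by
  rw [pullB, ← Matrix.mul_assoc, ← Matrix.mul_assoc, hW, Matrix.one_mul]

theorem pullA_one (hW : Wᴴ * W = 1) : pullA W 1 = 1 := by simp [pullA, hW]

theorem pullB_one (hW : Wᴴ * W = 1) : pullB W 1 = 1 := by simp [pullB, hW]

theorem controlledLoop_eq (h₁ : Wᴴ * W = 1) (h₂ : W * Wᴴ = 1) (Q Q' S T : Matrix D D ℂ) :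
    controlledLoop W Q Q' S T =
      W * (pullA W Q * pullB W Q' * (actA S * actB T) + pullA W Q * (1 - pullB W Q') * actA S
        + (1 - pullA W Q) * pullB W Q' * actB T + (1 - pullA W Q) * (1 - pullB W Q')) := by
  have hA : 1 - pullA W Q = pullA W (1 - Q) := by
    rw [sub_eq_iff_eq_add, ← pullA_add]; simp [pullA_one h₁]
  have hB : 1 - pullB W Q' = pullB W (1 - Q') := by
    rw [sub_eq_iff_eq_add, ← pullB_add]; simp [pullB_one h₁]
  simp only [controlledLoop, hA, hB, Matrix.mul_add, ← Matrix.mul_assoc, mul_pullA h₂]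
  have h : ∀ X Y : Matrix D D ℂ,
      actA (P := F) X * W * pullB W Y = actA (P := F) X * actB (P := F) Y * W := fun X Y => by
    rw [Matrix.mul_assoc, mul_pullB h₂, Matrix.mul_assoc]
  simp only [h]

theorem commutation_relations (h₁ : Wᴴ * W = 1) (h₂ : W * Wᴴ = 1)
    (hloop : ∀ Q Q' S T : Matrix D D ℂ, Q * Q = Q → Qᴴ = Q → Q' * Q' = Q' → Q'ᴴ = Q' →
      Sᴴ * S = 1 → S * Sᴴ = 1 → Tᴴ * T = 1 → T * Tᴴ = 1 →
      (controlledLoop W Q Q' S T)ᴴ * controlledLoop W Q Q' S T = 1) :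
    (∀ X S : Matrix D D ℂ, pullA W X * actA S = actA S * pullA W X) ∧
    (∀ Y T : Matrix D D ℂ, pullB W Y * actB T = actB T * pullB W Y) ∧
    ∀ X Y S T : Matrix D D ℂ,
      (pullA W X * actB T - actB T * pullA W X) *
        (pullB W Y * actA S - actA S * pullB W Y) = 0 := by
  have hq : ∀ X : Matrix D D ℂ, X * X = X →
      pullA W X * pullA W X = pullA W X := fun X hX => by
    rw [pullA_mul h₂, hX]
  have hr : ∀ X : Matrix D D ℂ, X * X = X →
      pullB W X * pullB W X = pullB W X := fun X hX => by
    rw [pullB_mul h₂, hX]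
  have hAu : ∀ S : Matrix D D ℂ, Sᴴ * S = 1 → (actA (P := P) S)ᴴ * actA S = 1 := fun S hS => by
    rw [conjTranspose_actA, actA_mul, hS, actA_one]
  have hAu' : ∀ S : Matrix D D ℂ, S * Sᴴ = 1 → actA (P := P) S * (actA S)ᴴ = 1 := fun S hS => by
    rw [conjTranspose_actA, actA_mul, hS, actA_one]
  have hBu : ∀ S : Matrix D D ℂ, Sᴴ * S = 1 → (actB (P := P) S)ᴴ * actB S = 1 := fun S hS => by
    rw [conjTranspose_actB, actB_mul, hS, actB_one]
  have hBu' : ∀ S : Matrix D D ℂ, S * Sᴴ = 1 → actB (P := P) S * (actB S)ᴴ = 1 := fun S hS => by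
    rw [conjTranspose_actB, actB_mul, hS, actB_one]
  have hG : ∀ Q Q' S T : Matrix D D ℂ, Q * Q = Q → Qᴴ = Q → Q' * Q' = Q' → Q'ᴴ = Q' →
      Sᴴ * S = 1 → S * Sᴴ = 1 → Tᴴ * T = 1 → T * Tᴴ = 1 →
      (pullA W Q * pullB W Q' * (actA S * actB T)
        + pullA W Q * (1 - pullB W Q') * actA S
        + (1 - pullA W Q) * pullB W Q' * actB T
        + (1 - pullA W Q) * (1 - pullB W Q'))ᴴ *
      (pullA W Q * pullB W Q' * (actA S * actB T)
        + pullA W Q * (1 - pullB W Q') * actA S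
        + (1 - pullA W Q) * pullB W Q' * actB T
        + (1 - pullA W Q) * (1 - pullB W Q')) = 1 := by
    intro Q Q' S T a b c e f g i j
    have h := hloop Q Q' S T a b c e f g i j
    rw [controlledLoop_eq h₁ h₂, conjTranspose_mul, Matrix.mul_assoc, ← Matrix.mul_assoc Wᴴ,
      h₁, Matrix.one_mul] at h
    exact h
  have hA0 : pullA W 0 = 0 := by simp [pullA, actA]
  have hB0 : pullB W 0 = 0 := by simp [pullB, actB]
  have hA1 : ∀ Q S : Matrix D D ℂ, Q * Q = Q → Qᴴ = Q → Sᴴ * S = 1 → S * Sᴴ = 1 →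
      pullA W Q * actA S = actA S * pullA W Q := by
    intro Q S a b c e
    refine commute_of_controlled_unitary (hq Q a) ?_ (hAu' S e) ?_
    · rw [star_eq_conjTranspose, conjTranspose_pullA, b]
    · have := hG Q 0 S 1 a b (by simp) (by simp) c e (by simp) (by simp)
      simpa [hB0, star_eq_conjTranspose] using this
  have hB1 : ∀ Q S : Matrix D D ℂ, Q * Q = Q → Qᴴ = Q → Sᴴ * S = 1 → S * Sᴴ = 1 →
      pullB W Q * actB S = actB S * pullB W Q := by
    intro Q S a b c e
    refine commute_of_controlled_unitary (hr Q a) ?_ (hBu' S e) ?_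
    · rw [star_eq_conjTranspose, conjTranspose_pullB, b]
    · have := hG 0 Q 1 S (by simp) (by simp) a b (by simp) (by simp) c e
      simpa [hA0, star_eq_conjTranspose] using this
  have hAB : ∀ Q Q' S T : Matrix D D ℂ, Q * Q = Q → Qᴴ = Q → Q' * Q' = Q' → Q'ᴴ = Q' →
      Sᴴ * S = 1 → S * Sᴴ = 1 → Tᴴ * T = 1 → T * Tᴴ = 1 →
      (pullA W Q * actB T - actB T * pullA W Q) *
        (pullB W Q' * actA S - actA S * pullB W Q') = 0 := by
    intro Q Q' S T a b c e f g i j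
    refine commutator_mul_commutator_eq_zero (hq Q a) ?_ (hr Q' c) ?_
      (pullA_mul_pullB h₂ _ _) (hAu S f)
      (hAu' S g) (hBu' T j) (actA_mul_actB _ _) (hA1 Q S a b f g) (hB1 Q' T c e i j)
      (hG Q Q' S T a b c e f g i j)
    · rw [star_eq_conjTranspose, conjTranspose_pullA, b]
    · rw [star_eq_conjTranspose, conjTranspose_pullB, e]
  have hAr : ∀ Q : Matrix D D ℂ,
      actA (P := P) (1 - (2 : ℂ) • Q) = 1 + (-2 : ℂ) • actA Q := fun Q => by
    rw [sub_eq_add_neg, ← neg_smul, actA_add, actA_smul, actA_one]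
  have hBr : ∀ Q : Matrix D D ℂ,
      actB (P := P) (1 - (2 : ℂ) • Q) = 1 + (-2 : ℂ) • actB Q := fun Q => by
    rw [sub_eq_add_neg, ← neg_smul, actB_add, actB_smul, actB_one]
  have hcomm : ∀ x y : Matrix (P × D × D) (P × D × D) ℂ,
      x * (1 + (-2 : ℂ) • y) - (1 + (-2 : ℂ) • y) * x = (-2 : ℂ) • (x * y - y * x) := by
    intro x y
    simp only [Matrix.mul_add, Matrix.add_mul, Matrix.mul_one, Matrix.one_mul, smul_mul_assoc,
      mul_smul_comm]
    module
  have h2 : (-2 : ℂ) ≠ 0 := by norm_num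
  refine ⟨fun X => ?_, fun X => ?_, fun X => ?_⟩
  · induction X using matrix_induction_on_projections with
    | hadd X Y hX hY =>
      intro S
      simp only [pullA_add, Matrix.mul_add, Matrix.add_mul, hX S, hY S]
    | hsmul c X hX => intro S; simp [pullA_smul, hX S]
    | hproj Q a b =>
      intro S
      induction S using matrix_induction_on_projections with
      | hadd X Y hX hY => simp only [actA_add, Matrix.mul_add, Matrix.add_mul, hX, hY]
      | hsmul c X hX => simp [actA_smul, hX]
      | hproj S c e =>
        have h := hA1 Q _ a b (reflection_unitary c e).1 (reflection_unitary c e).2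
        rw [hAr, ← sub_eq_zero, hcomm, smul_eq_zero_iff_right h2, sub_eq_zero] at h
        exact h
  · induction X using matrix_induction_on_projections with
    | hadd X Y hX hY =>
      intro S
      simp only [pullB_add, Matrix.mul_add, Matrix.add_mul, hX S, hY S]
    | hsmul c X hX => intro S; simp [pullB_smul, hX S]
    | hproj Q a b =>
      intro S
      induction S using matrix_induction_on_projections with
      | hadd X Y hX hY => simp only [actB_add, Matrix.mul_add, Matrix.add_mul, hX, hY]
      | hsmul c X hX => simp [actB_smul, hX]
      | hproj S c e =>
        have h := hB1 Q _ a b (reflection_unitary c e).1 (reflection_unitary c e).2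
        rw [hBr, ← sub_eq_zero, hcomm, smul_eq_zero_iff_right h2, sub_eq_zero] at h
        exact h
  · induction X using matrix_induction_on_projections with
    | hadd X Y hX hY =>
      intro Y' S T
      have h1 := hX Y' S T
      have h2 := hY Y' S T
      simp only [pullA_add, Matrix.mul_add, Matrix.add_mul] at h1 h2 ⊢
      rw [add_sub_add_comm, Matrix.add_mul, h1, h2, add_zero]
    | hsmul c X hX =>
      intro Y' S T
      have h := hX Y' S T
      simp only [pullA_smul, mul_smul_comm, smul_mul_assoc, ← smul_sub, h, smul_zero]
    | hproj Q a b =>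
    intro Y
    induction Y using matrix_induction_on_projections with
    | hadd X Y hX hY =>
      intro S T
      have h1 := hX S T
      have h2 := hY S T
      simp only [pullB_add, Matrix.mul_add, Matrix.add_mul] at h1 h2 ⊢
      rw [add_sub_add_comm, Matrix.mul_add, h1, h2, add_zero]
    | hsmul c X hX =>
      intro S T
      have h := hX S T
      simp only [pullB_smul, mul_smul_comm, smul_mul_assoc, ← smul_sub, h, smul_zero]
    | hproj Q' c e =>
    intro S
    induction S using matrix_induction_on_projections with
    | hadd X Y hX hY =>
      intro T
      have h1 := hX T
      have h2 := hY T
      simp only [actA_add, Matrix.mul_add, Matrix.add_mul] at h1 h2 ⊢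
      rw [add_sub_add_comm, Matrix.mul_add, h1, h2, add_zero]
    | hsmul c X hX =>
      intro T
      have h := hX T
      simp only [actA_smul, mul_smul_comm, smul_mul_assoc, ← smul_sub, h, smul_zero]
    | hproj S f g =>
    intro T
    induction T using matrix_induction_on_projections with
    | hadd X Y hX hY =>
      simp only [actB_add, Matrix.mul_add, Matrix.add_mul] at hX hY ⊢
      rw [add_sub_add_comm, Matrix.add_mul, hX, hY, add_zero]
    | hsmul c X hX =>
      simp only [actB_smul, mul_smul_comm, smul_mul_assoc, ← smul_sub, hX, smul_zero]
    | hproj T i j =>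
      have h := hAB Q Q' _ _ a b c e (reflection_unitary f g).1 (reflection_unitary f g).2
        (reflection_unitary i j).1 (reflection_unitary i j).2
      rw [hAr, hBr, hcomm, hcomm, smul_mul_assoc, mul_smul_comm, smul_eq_zero_iff_right h2,
        smul_eq_zero_iff_right h2] at h
      exact h

end pullback

/-- The operator acting as `c` on the first tensor factor. -/
noncomputable def actP {P D : Type*} [DecidableEq D] (c : Matrix P P ℂ) :
    Matrix (P × D × D) (P × D × D) ℂ :=
  kroneckerMap (· * ·) c (1 : Matrix (D × D) (D × D) ℂ)

/-- The blocks of a matrix with respect to the second and third tensor factors. -/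
def block {F P D : Type*} (M : Matrix (F × D × D) (P × D × D) ℂ) (a b a' b' : D) :
    Matrix F P ℂ :=
  fun f p => M (f, a, b) (p, a', b')

section block

variable {F G P D : Type*}

theorem block_ext {M N : Matrix (F × D × D) (P × D × D) ℂ}
    (h : ∀ a b a' b', block M a b a' b' = block N a b a' b') : M = N := by
  ext ⟨f, a, b⟩ ⟨p, a', b'⟩
  exact congrFun₂ (h a b a' b') f p

theorem block_conjTranspose (M : Matrix (F × D × D) (P × D × D) ℂ) (a b a' b' : D) :
    block Mᴴ a b a' b' = (block M a' b' a b)ᴴ := rfl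

theorem block_sub (M N : Matrix (F × D × D) (P × D × D) ℂ) (a b a' b' : D) :
    block (M - N) a b a' b' = block M a b a' b' - block N a b a' b' := rfl

variable [DecidableEq D]

theorem block_actP (c : Matrix P P ℂ) (a b a' b' : D) :
    block (actP c) a b a' b' = if a = a' ∧ b = b' then c else 0 := by
  ext p p'
  simp only [block, actP, kroneckerMap_apply, one_apply, Prod.mk.injEq]
  split_ifs <;> simp

theorem block_one [DecidableEq P] (a b a' b' : D) :
    block (1 : Matrix (P × D × D) (P × D × D) ℂ) a b a' b'
      = if a = a' ∧ b = b' then 1 else 0 := by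
  ext p p'
  simp only [block, one_apply, Prod.mk.injEq]
  by_cases h : a = a' ∧ b = b' <;> simp [h, one_apply]

theorem conjTranspose_actP (c : Matrix P P ℂ) : (actP (D := D) c)ᴴ = actP cᴴ := by
  simp [actP, conjTranspose_kronecker]

theorem actP_injective [Nonempty D] : Function.Injective (actP (P := P) (D := D)) := by
  intro c c' h
  obtain ⟨a⟩ := ‹Nonempty D›
  have := congrArg (fun M => block M a a a a) h
  simpa [block_actP] using this

theorem actP_one [DecidableEq P] : actP (D := D) (1 : Matrix P P ℂ) = 1 := by
  simp [actP]

theorem actP_sub (c c' : Matrix P P ℂ) : actP (D := D) (c - c') = actP c - actP c' := by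
  refine block_ext fun a b a' b' => ?_
  simp only [block_sub, block_actP]
  split_ifs <;> simp

variable [Fintype D]

theorem block_mul [Fintype G] (M : Matrix (F × D × D) (G × D × D) ℂ)
    (N : Matrix (G × D × D) (P × D × D) ℂ) (a b a' b' : D) :
    block (M * N) a b a' b'
      = ∑ a'', ∑ b'', block M a b a'' b'' * block N a'' b'' a' b' := by
  ext f p
  simp only [block, Matrix.mul_apply, Fintype.sum_prod_type, Matrix.sum_apply]
  rw [Finset.sum_comm]
  exact Finset.sum_congr rfl fun _ _ => Finset.sum_comm

variable [Fintype P]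

theorem actP_mul (c c' : Matrix P P ℂ) : actP (D := D) c * actP c' = actP (c * c') := by
  simp [actP, ← mul_kronecker_mul]

theorem block_mul_actP (M : Matrix (F × D × D) (P × D × D) ℂ) (c : Matrix P P ℂ)
    (a b a' b' : D) : block (M * actP (D := D) c) a b a' b' = block M a b a' b' * c := by
  simp only [block_mul, block_actP]
  rw [Finset.sum_eq_single a' (fun a'' _ h => by simp [h]) (by simp),
    Finset.sum_eq_single b' (fun b'' _ h => by simp [h]) (by simp)]
  simp

variable [Fintype F] [DecidableEq F] [DecidableEq P]

theorem block_actA_mul (M : Matrix (F × D × D) (P × D × D) ℂ) (i j a b a' b' : D) :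
    block (actA (P := F) (single i j 1) * M) a b a' b'
      = if a = i then block M j b a' b' else 0 := by
  have : ∀ a'' b'', block (actA (P := F) (single i j 1)) a b a'' b''
      = if i = a ∧ j = a'' ∧ b = b'' then 1 else 0 := fun a'' b'' => by
    ext f f'
    simp only [block, actA, kroneckerMap_apply, one_apply, single_apply]
    by_cases h : i = a <;> by_cases h' : j = a'' <;> by_cases h'' : b = b'' <;>
      simp [h, h', h'', one_apply]
  simp only [block_mul, this]
  rw [Finset.sum_eq_single j (fun a'' _ h => by simp [h.symm]) (by simp),
    Finset.sum_eq_single b (fun b'' _ h => by simp [h.symm]) (by simp)]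
  by_cases h : a = i
  · simp [h]
  · simp [h, Ne.symm h]

theorem block_actB_mul (M : Matrix (F × D × D) (P × D × D) ℂ) (i j a b a' b' : D) :
    block (actB (P := F) (single i j 1) * M) a b a' b'
      = if b = i then block M a j a' b' else 0 := by
  have : ∀ a'' b'', block (actB (P := F) (single i j 1)) a b a'' b''
      = if i = b ∧ j = b'' ∧ a = a'' then 1 else 0 := fun a'' b'' => by
    ext f f'
    simp only [block, actB, kroneckerMap_apply, one_apply, single_apply]
    by_cases h : i = b <;> by_cases h' : j = b'' <;> by_cases h'' : a = a'' <;>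
      simp [h, h', h'', one_apply]
  simp only [block_mul, this]
  rw [Finset.sum_eq_single a (fun a'' _ h => by simp [h.symm]) (by simp),
    Finset.sum_eq_single j (fun b'' _ h => by simp [h.symm]) (by simp)]
  by_cases h : b = i
  · simp [h]
  · simp [h, Ne.symm h]

theorem block_mul_actA (M : Matrix (F × D × D) (P × D × D) ℂ) (i j a b a' b' : D) :
    block (M * actA (P := P) (single i j 1)) a b a' b'
      = if a' = j then block M a b i b' else 0 := by
  have h := block_actA_mul Mᴴ j i a' b' a b
  rw [← conjTranspose_inj, ← block_conjTranspose, conjTranspose_mul, conjTranspose_actA,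
    conjTranspose_single, star_one, h]
  split_ifs <;> simp [block_conjTranspose]

theorem block_mul_actB (M : Matrix (F × D × D) (P × D × D) ℂ) (i j a b a' b' : D) :
    block (M * actB (P := P) (single i j 1)) a b a' b'
      = if b' = j then block M a b a' i else 0 := by
  have h := block_actB_mul Mᴴ j i a' b' a b
  rw [← conjTranspose_inj, ← block_conjTranspose, conjTranspose_mul, conjTranspose_actB,
    conjTranspose_single, star_one, h]
  split_ifs <;> simp [block_conjTranspose]

theorem exists_block_eq_of_commute_actA [Nonempty D] {M : Matrix (P × D × D) (P × D × D) ℂ}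
    (h : ∀ X : Matrix D D ℂ, M * actA X = actA X * M) :
    ∃ c : D → D → Matrix P P ℂ, ∀ a b a' b',
      block M a b a' b' = if a = a' then c b b' else 0 := by
  obtain ⟨o⟩ := ‹Nonempty D›
  have key : ∀ i j a b a' b', (if a' = j then block M a b i b' else 0)
      = if a = i then block M j b a' b' else 0 := fun i j a b a' b' => by
    rw [← block_mul_actA, h, block_actA_mul]
  refine ⟨fun b b' => block M o b o b', fun a b a' b' => ?_⟩
  split_ifs with haa
  · subst haa
    simpa using key a o a b o b'
  · simpa [haa] using key a' a' a b a' b'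

theorem exists_block_eq_of_commute_actB [Nonempty D] {M : Matrix (P × D × D) (P × D × D) ℂ}
    (h : ∀ X : Matrix D D ℂ, M * actB X = actB X * M) :
    ∃ c : D → D → Matrix P P ℂ, ∀ a b a' b',
      block M a b a' b' = if b = b' then c a a' else 0 := by
  obtain ⟨o⟩ := ‹Nonempty D›
  have key : ∀ i j a b a' b', (if b' = j then block M a b a' i else 0)
      = if b = i then block M a j a' b' else 0 := fun i j a b a' b' => by
    rw [← block_mul_actB, h, block_actB_mul]
  refine ⟨fun a a' => block M a o a' o, fun a b a' b' => ?_⟩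
  split_ifs with haa
  · subst haa
    simpa using key b o a b a' o
  · simpa [haa] using key b' b' a b a' b'

theorem exists_eq_actP_of_commute [Nonempty D] {M : Matrix (P × D × D) (P × D × D) ℂ}
    (hA : ∀ X : Matrix D D ℂ, M * actA X = actA X * M)
    (hB : ∀ X : Matrix D D ℂ, M * actB X = actB X * M) :
    ∃ c : Matrix P P ℂ, M = actP c := by
  obtain ⟨c, hc⟩ := exists_block_eq_of_commute_actA hA
  obtain ⟨c', hc'⟩ := exists_block_eq_of_commute_actB hB
  obtain ⟨o⟩ := ‹Nonempty D›
  refine ⟨c o o, block_ext fun a b a' b' => ?_⟩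
  rw [block_actP]
  split_ifs with h
  · obtain ⟨rfl, rfl⟩ := h
    have h1 := (hc' a b a b).symm.trans (hc a b a b)
    have h2 := (hc' a o a o).symm.trans (hc a o a o)
    rw [hc' a b a b, if_pos rfl]
    simpa using h2
  · rcases not_and_or.1 h with h | h
    · rw [hc, if_neg h]
    · rw [hc', if_neg h]

end block

theorem commute_of_mul_kernel_projection {n : Type*} [Fintype n] [DecidableEq n]
    {N : Set (Matrix n n ℂ)} {q C : Matrix n n ℂ} (hq : qᴴ = q)
    (hN : ∀ B : Matrix n n ℂ, (∀ l ∈ N, B * lᴴ = 0) → B * (1 - q) = 0)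
    (h₁ : ∀ l ∈ N, l * (C * q) = 0) (h₂ : ∀ l ∈ N, l * (Cᴴ * q) = 0) : C * q = q * C := by
  have key : ∀ C : Matrix n n ℂ, (∀ l ∈ N, l * (C * q) = 0) → C * q = q * (C * q) := by
    intro C h
    have := hN (C * q)ᴴ fun l hl => by rw [← conjTranspose_mul, h l hl, conjTranspose_zero]
    have := congrArg conjTranspose this
    rw [conjTranspose_mul, conjTranspose_conjTranspose, conjTranspose_sub, hq,
      conjTranspose_one, conjTranspose_zero, Matrix.sub_mul, Matrix.one_mul, sub_eq_zero] at this
    exact this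
  have h := congrArg conjTranspose (key _ h₂)
  simp only [conjTranspose_mul, conjTranspose_conjTranspose, hq] at h
  rw [key C h₁, h, Matrix.mul_assoc]

theorem exists_sector_projection {F P D : Type*} [Fintype F] [DecidableEq F] [Fintype P]
    [DecidableEq P] [Fintype D] [DecidableEq D] [Nonempty D]
    {W : Matrix (F × D × D) (P × D × D) ℂ} (hW : W * Wᴴ = 1)
    (hA : ∀ X S : Matrix D D ℂ, pullA W X * actA S = actA S * pullA W X)
    (hB : ∀ Y T : Matrix D D ℂ, pullB W Y * actB T = actB T * pullB W Y)
    (hAB : ∀ X Y S T : Matrix D D ℂ, (pullA W X * actB T - actB T * pullA W X) *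
      (pullB W Y * actA S - actA S * pullB W Y) = 0) :
    ∃ π : Matrix P P ℂ, π * π = π ∧ πᴴ = π ∧
      (∀ X, pullA W X * actP π = actP π * pullA W X) ∧
      (∀ Y, pullB W Y * actP π = actP π * pullB W Y) ∧
      (∀ X, ∃ c, pullA W X * actP π = actP c ∧ π * c = c) ∧
      ∀ Y, ∃ c, pullB W Y * actP (1 - π) = actP c ∧ (1 - π) * c = c := by
  obtain ⟨q, hqq, hq, hNq, hN⟩ := exists_common_kernel_projection
    {l : Matrix (P × D × D) (P × D × D) ℂ |
      ∃ X T : Matrix D D ℂ, l = pullA W X * actB T - actB T * pullA W X}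
  have h0 : ∀ X T : Matrix D D ℂ, pullA W X * actB T * q = actB T * pullA W X * q :=
    fun X T => by
      rw [← sub_eq_zero, ← Matrix.sub_mul]
      exact hNq _ ⟨X, T, rfl⟩
  have hqA : ∀ S : Matrix D D ℂ, actA S * q = q * actA S := by
    have key : ∀ S, ∀ l ∈ {l : Matrix (P × D × D) (P × D × D) ℂ |
        ∃ X T : Matrix D D ℂ, l = pullA W X * actB T - actB T * pullA W X},
        l * (actA S * q) = 0 := by
      rintro S _ ⟨X, T, rfl⟩
      rw [← Matrix.mul_assoc, Matrix.sub_mul, Matrix.mul_assoc _ (actB T), ← actA_mul_actB,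
        ← Matrix.mul_assoc, hA, Matrix.mul_assoc (actB T), hA, ← Matrix.mul_assoc (actB T),
        ← actA_mul_actB, Matrix.mul_assoc (actA S), Matrix.mul_assoc (actA S),
        ← Matrix.mul_sub, Matrix.mul_assoc, hNq _ ⟨X, T, rfl⟩, Matrix.mul_zero]
    intro S
    exact commute_of_mul_kernel_projection hq hN (key S)
      (by rw [conjTranspose_actA]; exact key _)
  have hqB : ∀ T : Matrix D D ℂ, actB T * q = q * actB T := by
    have key : ∀ S, ∀ l ∈ {l : Matrix (P × D × D) (P × D × D) ℂ |
        ∃ X T : Matrix D D ℂ, l = pullA W X * actB T - actB T * pullA W X},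
        l * (actB S * q) = 0 := by
      rintro S _ ⟨X, T, rfl⟩
      calc _ = pullA W X * (actB T * actB S) * q - actB T * (pullA W X * actB S * q) := by
            simp only [Matrix.sub_mul, Matrix.mul_assoc]
        _ = _ := by
            rw [h0, actB_mul, h0, ← actB_mul]
            simp only [Matrix.mul_assoc, sub_self]
    intro S
    exact commute_of_mul_kernel_projection hq hN (key S)
      (by rw [conjTranspose_actB]; exact key _)
  have hqα : ∀ X : Matrix D D ℂ, pullA W X * q = q * pullA W X := by
    have key : ∀ Y, ∀ l ∈ {l : Matrix (P × D × D) (P × D × D) ℂ |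
        ∃ X T : Matrix D D ℂ, l = pullA W X * actB T - actB T * pullA W X},
        l * (pullA W Y * q) = 0 := by
      rintro Y _ ⟨X, T, rfl⟩
      calc _ = pullA W X * (actB T * pullA W Y * q)
            - actB T * (pullA W X * pullA W Y) * q := by
            simp only [Matrix.sub_mul, Matrix.mul_assoc]
        _ = _ := by
            rw [← h0, pullA_mul hW, ← h0, ← pullA_mul hW]
            simp only [Matrix.mul_assoc, sub_self]
    intro S
    exact commute_of_mul_kernel_projection hq hN (key S)
      (by rw [conjTranspose_pullA]; exact key _)
  have hqβ : ∀ X : Matrix D D ℂ, pullB W X * q = q * pullB W X := by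
    have key : ∀ Y, ∀ l ∈ {l : Matrix (P × D × D) (P × D × D) ℂ |
        ∃ X T : Matrix D D ℂ, l = pullA W X * actB T - actB T * pullA W X},
        l * (pullB W Y * q) = 0 := by
      rintro S _ ⟨X, T, rfl⟩
      rw [← Matrix.mul_assoc, Matrix.sub_mul, Matrix.mul_assoc _ (actB T), ← hB,
        ← Matrix.mul_assoc, pullA_mul_pullB hW, Matrix.mul_assoc (actB T),
        pullA_mul_pullB hW, ← Matrix.mul_assoc (actB T), ← hB, Matrix.mul_assoc (pullB W S),
        Matrix.mul_assoc (pullB W S), ← Matrix.mul_sub, Matrix.mul_assoc,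
        hNq _ ⟨X, T, rfl⟩, Matrix.mul_zero]
    intro S
    exact commute_of_mul_kernel_projection hq hN (key S)
      (by rw [conjTranspose_pullB]; exact key _)
  have hsec : ∀ Y S : Matrix D D ℂ,
      pullB W Y * actA S * (1 - q) = actA S * pullB W Y * (1 - q) := by
    intro Y S
    rw [← sub_eq_zero, ← Matrix.sub_mul]
    refine hN _ ?_
    rintro _ ⟨X, T, rfl⟩
    have h := congrArg conjTranspose (hAB X Yᴴ Sᴴ T)
    rw [conjTranspose_mul, conjTranspose_zero, conjTranspose_sub (pullB W Yᴴ * _)] at h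
    simp only [conjTranspose_mul (pullB W _), conjTranspose_mul (actA _), conjTranspose_pullB,
      conjTranspose_actA, conjTranspose_conjTranspose] at h
    rw [← neg_sub, Matrix.neg_mul, h, neg_zero]
  obtain ⟨π, rfl⟩ := exists_eq_actP_of_commute (fun X => (hqA X).symm) (fun X => (hqB X).symm)
  rw [actP_mul] at hqq
  rw [conjTranspose_actP] at hq
  have hππ : π * π = π := actP_injective hqq
  have h1 : actP (D := D) (1 - π) = 1 - actP π := by rw [actP_sub, actP_one]
  refine ⟨π, hππ, actP_injective hq, hqα, hqβ, fun X => ?_, fun Y => ?_⟩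
  · obtain ⟨c, hc⟩ := exists_eq_actP_of_commute (M := pullA W X * actP π)
      (fun S => by rw [Matrix.mul_assoc, ← hqA, ← Matrix.mul_assoc, hA, Matrix.mul_assoc])
      (fun T => by rw [Matrix.mul_assoc, ← hqB, ← Matrix.mul_assoc, h0, Matrix.mul_assoc])
    refine ⟨c, hc, actP_injective (D := D) ?_⟩
    rw [← actP_mul, ← hc, hqα, ← Matrix.mul_assoc, actP_mul, hππ]
  · have hcomm : ∀ M : Matrix (P × D × D) (P × D × D) ℂ, M * actP π = actP π * M →
        M * (1 - actP π) = (1 - actP π) * M := fun M hM => by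
      rw [Matrix.mul_sub, Matrix.sub_mul, hM, Matrix.mul_one, Matrix.one_mul]
    obtain ⟨c, hc⟩ := exists_eq_actP_of_commute (M := pullB W Y * actP (1 - π))
      (fun S => by
        rw [h1, Matrix.mul_assoc, ← hcomm _ (hqA S), ← Matrix.mul_assoc, hsec,
          Matrix.mul_assoc])
      (fun T => by
        rw [h1, Matrix.mul_assoc, ← hcomm _ (hqB T), ← Matrix.mul_assoc, hB,
          Matrix.mul_assoc])
    refine ⟨c, hc, actP_injective (D := D) ?_⟩
    have : (1 - π) * (1 - π) = 1 - π := by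
      simp [Matrix.mul_sub, Matrix.sub_mul, hππ]
    rw [← actP_mul, ← hc, h1, hcomm _ (hqβ Y), ← Matrix.mul_assoc, ← h1, actP_mul, this]

theorem exists_two_order_decomposition {F P : Type*} [Fintype F] [DecidableEq F] [Fintype P]
    [DecidableEq P] {d : ℕ} [NeZero d] {W : Matrix (F × Fin d × Fin d) (P × Fin d × Fin d) ℂ}
    (h₁ : Wᴴ * W = 1) (hW : W * Wᴴ = 1)
    (hA : ∀ X S : Matrix (Fin d) (Fin d) ℂ, pullA W X * actA S = actA S * pullA W X)
    (hB : ∀ Y T : Matrix (Fin d) (Fin d) ℂ, pullB W Y * actB T = actB T * pullB W Y)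
    (hAB : ∀ X Y S T : Matrix (Fin d) (Fin d) ℂ,
      (pullA W X * actB T - actB T * pullA W X) *
        (pullB W Y * actA S - actA S * pullB W Y) = 0) :
    ∃ (m m' : ℕ) (S : Fin d → Matrix P (Fin m) ℂ) (S' : Fin d → Matrix P (Fin m') ℂ)
      (R : Matrix (Fin d × Fin m) (Fin d × Fin m) ℂ)
      (R' : Matrix (Fin d × Fin m') (Fin d × Fin m') ℂ)
      (Z : Fin d → Matrix F (Fin m) ℂ) (Z' : Fin d → Matrix F (Fin m') ℂ),
      (∀ i j, (S i)ᴴ * S j = if i = j then 1 else 0) ∧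
      (∀ i j, (S' i)ᴴ * S' j = if i = j then 1 else 0) ∧
      ∑ i, S i * (S i)ᴴ + ∑ i, S' i * (S' i)ᴴ = 1 ∧
      Rᴴ * R = 1 ∧ R * Rᴴ = 1 ∧ R'ᴴ * R' = 1 ∧ R' * R'ᴴ = 1 ∧
      ∑ i, Z i * (Z i)ᴴ + ∑ i, Z' i * (Z' i)ᴴ = 1 ∧
      ∀ a b a' b', block W a b a' b' =
        Z b' * R.submatrix (fun y => (b, y)) (fun x => (a', x)) * (S a)ᴴ +
        Z' a' * R'.submatrix (fun y => (a, y)) (fun x => (b', x)) * (S' b)ᴴ := by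
  obtain ⟨π, hππ, hπ, hqα, hqβ, hα, hβ⟩ := exists_sector_projection hW hA hB hAB
  have hππ' : (1 - π) * (1 - π) = 1 - π := by simp [Matrix.mul_sub, Matrix.sub_mul, hππ]
  have hπ' : (1 - π)ᴴ = 1 - π := by simp [hπ]
  have hcol : ∀ a' b' a'' b'', ∑ a, ∑ b, (block W a b a' b')ᴴ * block W a b a'' b''
      = if a' = a'' ∧ b' = b'' then 1 else 0 := fun a' b' a'' b'' => by
    rw [← block_one, ← h₁, block_mul]
    rfl
  have hiso : ∀ ρ : Matrix P P ℂ, ρ * ρ = ρ → ρᴴ = ρ → ∀ a' b' a'' b'',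
      ∑ a, ∑ b, (block W a b a' b' * ρ)ᴴ * (block W a b a'' b'' * ρ)
        = if a' = a'' ∧ b' = b'' then ρ else 0 := by
    intro ρ hρ hρ' a' b' a'' b''
    have : ∑ a, ∑ b, (block W a b a' b' * ρ)ᴴ * (block W a b a'' b'' * ρ)
        = ρ * (∑ a, ∑ b, (block W a b a' b')ᴴ * block W a b a'' b'') * ρ := by
      simp only [Matrix.mul_sum, Matrix.sum_mul, conjTranspose_mul, hρ', Matrix.mul_assoc]
    rw [this, hcol]
    split_ifs <;> simp [hρ]
  have hrow : ∀ ρ : Matrix P P ℂ, ρ * ρ = ρ → ρᴴ = ρ → ∀ a b a' b',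
      block W a b a' b' * ρ * (block W a b a' b' * ρ)ᴴ
        = block W a b a' b' * ρ * (block W a b a' b')ᴴ := by
    intro ρ hρ hρ' a b a' b'
    rw [conjTranspose_mul, hρ', Matrix.mul_assoc, ← Matrix.mul_assoc ρ, hρ,
      ← Matrix.mul_assoc]
  have hcomp : ∀ M : Matrix (P × Fin d × Fin d) (P × Fin d × Fin d) ℂ,
      M * actP π = actP π * M → M * actP (1 - π) = actP (1 - π) * M := fun M hM => by
    rw [actP_sub, actP_one, Matrix.mul_sub, Matrix.sub_mul, hM, Matrix.mul_one,
      Matrix.one_mul]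
  have ite_mul' : ∀ (c : Prop) [Decidable c] (M : Matrix F P ℂ) (N : Matrix P P ℂ),
      (if c then M else 0) * N = if c then M * N else 0 := fun c _ M N => by
    split_ifs <;> simp
  obtain ⟨m, S, R, Z, hS, hSS, hR, hR', hZ, hdec⟩ := exists_fixed_order_circuit
    (W := fun a b a' b' => block W a b a' b' * π) (π := π) (hiso π hππ hπ)
    (fun a b a' b' => by rw [Matrix.mul_assoc, hππ])
    (fun i j => by
      obtain ⟨c, hc, hc'⟩ := hα (single i j 1)
      refine ⟨c, hc', fun a b a' b' => ?_⟩
      rw [Matrix.mul_assoc, hc', ← block_mul_actP, ← hc, ← Matrix.mul_assoc, mul_pullA hW,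
        block_mul_actP, block_actA_mul, ite_mul'])
    (fun i j => by
      obtain ⟨c, hc⟩ := exists_block_eq_of_commute_actB (hB (single i j 1))
      refine ⟨c, fun a b a' b' => ?_⟩
      have h : block (W * actP (D := Fin d) π * pullB W (single i j 1)) a b a' b'
          = if b = i then block W a j a' b' * π else 0 := by
        rw [Matrix.mul_assoc, ← hqβ, ← Matrix.mul_assoc, mul_pullB hW, block_mul_actP,
          block_actB_mul, ite_mul']
      rw [← h, block_mul]
      refine Finset.sum_congr rfl fun a'' _ => ?_
      simp only [hc, block_mul_actP]
      rw [Finset.sum_eq_single b' (fun b'' _ hb => by simp [hb]) (by simp), if_pos rfl])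
  obtain ⟨m', S', R', Z', hS', hSS', hR₁', hR₂', hZ', hdec'⟩ := exists_fixed_order_circuit
    (W := fun a b a' b' => block W b a b' a' * (1 - π)) (π := 1 - π)
    (fun a' b' a'' b'' => by
      rw [Finset.sum_comm, hiso _ hππ' hπ']
      simp only [and_comm])
    (fun a b a' b' => by rw [Matrix.mul_assoc, hππ'])
    (fun i j => by
      obtain ⟨c, hc, hc'⟩ := hβ (single i j 1)
      refine ⟨c, hc', fun a b a' b' => ?_⟩
      rw [Matrix.mul_assoc, hc', ← block_mul_actP, ← hc, ← Matrix.mul_assoc, mul_pullB hW,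
        block_mul_actP, block_actB_mul, ite_mul'])
    (fun i j => by
      obtain ⟨c, hc⟩ := exists_block_eq_of_commute_actA (hA (single i j 1))
      refine ⟨c, fun a b a' b' => ?_⟩
      have h : block (W * actP (D := Fin d) (1 - π) * pullA W (single i j 1)) b a b' a'
          = if b = i then block W j a b' a' * (1 - π) else 0 := by
        rw [Matrix.mul_assoc, ← hcomp _ (hqα _), ← Matrix.mul_assoc, mul_pullA hW,
          block_mul_actP, block_actA_mul, ite_mul']
      rw [← h, block_mul, Finset.sum_comm]
      refine Finset.sum_congr rfl fun a'' _ => ?_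
      simp only [hc, block_mul_actP]
      rw [Finset.sum_eq_single b' (fun b'' _ hb => by simp [hb]) (by simp), if_pos rfl])
  refine ⟨m, m', S, S', R, R', Z, Z', hS, hS', ?_, hR, hR', hR₁', hR₂', ?_, ?_⟩
  · rw [hSS, hSS', add_sub_cancel]
  · rw [← hZ, ← hZ']
    simp only [hrow _ hππ hπ, hrow _ hππ' hπ']
    rw [Finset.sum_comm (γ := Fin d) (f := fun a' b' => _ * (1 - π) * _)]
    have h : block (W * Wᴴ) 0 0 0 0 = 1 := by rw [hW, block_one]; simp
    rw [← h, block_mul]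
    simp only [← Finset.sum_add_distrib]
    refine Finset.sum_congr rfl fun a' _ => Finset.sum_congr rfl fun b' _ => ?_
    rw [← Matrix.add_mul, ← Matrix.mul_add, add_sub_cancel, Matrix.mul_one,
      block_conjTranspose]
  · intro a b a' b'
    rw [← hdec, ← hdec' b a b' a', ← Matrix.mul_add, add_sub_cancel, Matrix.mul_one]

theorem card_eq_of_unitary {m n : Type*} [Fintype m] [DecidableEq m] [Fintype n]
    [DecidableEq n] {M : Matrix m n ℂ} (h₁ : Mᴴ * M = 1) (h₂ : M * Mᴴ = 1) :
    Fintype.card m = Fintype.card n := by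
  have h := trace_mul_comm M Mᴴ
  rw [h₁, h₂, trace_one, trace_one] at h
  exact_mod_cast h

theorem submatrix_unitary {m n m' n' : Type*} [Fintype m] [DecidableEq m] [Fintype n]
    [DecidableEq n] [Fintype m'] [DecidableEq m'] [Fintype n'] [DecidableEq n']
    {M : Matrix m n ℂ} (h₁ : Mᴴ * M = 1) (h₂ : M * Mᴴ = 1) (e : m' ≃ m) (e' : n' ≃ n) :
    (M.submatrix e e')ᴴ * M.submatrix e e' = 1 ∧
      M.submatrix e e' * (M.submatrix e e')ᴴ = 1 := by
  rw [conjTranspose_submatrix, submatrix_mul_equiv, submatrix_mul_equiv, h₁, h₂]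
  simp

theorem exists_unitary_eq_on_zero {m n : Type*} [Fintype m] [DecidableEq m] [Fintype n]
    [DecidableEq n] (hcard : Fintype.card m = 2 * Fintype.card n) {J : Matrix m n ℂ}
    (hJ : Jᴴ * J = 1) :
    ∃ ω : Matrix m (Fin 2 × n) ℂ, ωᴴ * ω = 1 ∧ ω * ωᴴ = 1 ∧ ∀ i j, ω i (0, j) = J i j := by
  obtain ⟨J', h₁, h₂⟩ := exists_unitary_extension (k := n) (by rw [hcard, two_mul]) hJ
  let e : Fin 2 × n ≃ n ⊕ n :=
    (finTwoEquiv.prodCongr (Equiv.refl n)).trans (Equiv.boolProdEquivSum n)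
  obtain ⟨h₁', h₂'⟩ := submatrix_unitary h₁ h₂ (Equiv.refl m) e
  exact ⟨_, h₁', h₂', fun i j => rfl⟩

/-- The two families `S`, `S'` of matrices, selected by a control qubit and stacked along the
memory `Fin m ⊕ Fin m'`. -/
noncomputable def stack {P : Type*} {d m m' : ℕ} (S : Fin d → Matrix P (Fin m) ℂ)
    (S' : Fin d → Matrix P (Fin m') ℂ) : Matrix (Fin d × Fin (m + m') × Fin 2) P ℂ :=
  fun i p => Sum.elim (fun x => if i.2.2 = 0 then star (S i.1 p x) else 0)
    (fun x => if i.2.2 = 1 then star (S' i.1 p x) else 0) (finSumFinEquiv.symm i.2.1)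

theorem conjTranspose_stack_mul_stack {P : Type*} [Fintype P] [DecidableEq P] {d m m' : ℕ}
    {S : Fin d → Matrix P (Fin m) ℂ} {S' : Fin d → Matrix P (Fin m') ℂ}
    (h : ∑ i, S i * (S i)ᴴ + ∑ i, S' i * (S' i)ᴴ = 1) : (stack S S')ᴴ * stack S S' = 1 := by
  rw [← h]
  ext p p'
  simp only [Matrix.mul_apply, conjTranspose_apply, stack, Fintype.sum_prod_type, Matrix.add_apply,
    Matrix.sum_apply, Fin.sum_univ_two, ← Finset.sum_add_distrib]
  refine Finset.sum_congr rfl fun i _ => ?_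
  rw [← finSumFinEquiv.sum_comp]
  simp

/-- The direct sum of two operators, along the decomposition `Fin m ⊕ Fin m'` of a memory. -/
noncomputable def memorySum {d m m' : ℕ} (R : Matrix (Fin d × Fin m) (Fin d × Fin m) ℂ)
    (R' : Matrix (Fin d × Fin m') (Fin d × Fin m') ℂ) :
    Matrix (Fin d × Fin (m + m')) (Fin d × Fin (m + m')) ℂ :=
  let e := ((Equiv.refl (Fin d)).prodCongr finSumFinEquiv.symm).trans
    (Equiv.prodSumDistrib (Fin d) (Fin m) (Fin m'))
  (fromBlocks R 0 0 R').submatrix e e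

theorem memorySum_unitary {d m m' : ℕ} {R : Matrix (Fin d × Fin m) (Fin d × Fin m) ℂ}
    {R' : Matrix (Fin d × Fin m') (Fin d × Fin m') ℂ} (h₁ : Rᴴ * R = 1) (h₂ : R * Rᴴ = 1)
    (h₁' : R'ᴴ * R' = 1) (h₂' : R' * R'ᴴ = 1) :
    (memorySum R R')ᴴ * memorySum R R' = 1 ∧ memorySum R R' * (memorySum R R')ᴴ = 1 := by
  refine submatrix_unitary ?_ ?_ _ _
  · simp [fromBlocks_conjTranspose, fromBlocks_multiply, h₁, h₁']
  · simp [fromBlocks_conjTranspose, fromBlocks_multiply, h₂, h₂']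

theorem exists_temporal_circuit {F P : Type*} [Fintype F] [DecidableEq F] [Fintype P]
    [DecidableEq P] {d : ℕ} [NeZero d] {W : Matrix (F × Fin d × Fin d) (P × Fin d × Fin d) ℂ}
    (h₁ : Wᴴ * W = 1) (h₂ : W * Wᴴ = 1)
    (hloop : ∀ Q Q' S T : Matrix (Fin d) (Fin d) ℂ, Q * Q = Q → Qᴴ = Q → Q' * Q' = Q' →
      Q'ᴴ = Q' → Sᴴ * S = 1 → S * Sᴴ = 1 → Tᴴ * T = 1 → T * Tᴴ = 1 →
      (controlledLoop W Q Q' S T)ᴴ * controlledLoop W Q Q' S T = 1) :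
    ∃ (n : ℕ) (ω₁ : Matrix (Fin d × Fin n × Fin 2) (Fin 2 × P) ℂ)
      (ω₂c ω₂b : Matrix (Fin d × Fin n) (Fin d × Fin n) ℂ)
      (ω₃ : Matrix (Fin 2 × F) (Fin d × Fin n × Fin 2) ℂ),
      ω₁ᴴ * ω₁ = 1 ∧ ω₁ * ω₁ᴴ = 1 ∧ ω₂cᴴ * ω₂c = 1 ∧ ω₂c * ω₂cᴴ = 1 ∧
      ω₂bᴴ * ω₂b = 1 ∧ ω₂b * ω₂bᴴ = 1 ∧ ω₃ᴴ * ω₃ = 1 ∧ ω₃ * ω₃ᴴ = 1 ∧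
      ∀ f a b p a' b', W (f, a, b) (p, a', b') =
        ∑ x, ∑ y, ω₁ (a, x, 0) (0, p) * ω₂c (b, y) (a', x) * ω₃ (0, f) (b', y, 0) +
        ∑ x, ∑ y, ω₁ (b, x, 1) (0, p) * ω₂b (a, y) (b', x) * ω₃ (0, f) (a', y, 1) := by
  obtain ⟨hA, hB, hAB⟩ := commutation_relations h₁ h₂ hloop
  obtain ⟨m, m', S, S', R, R', Z, Z', hS, hS', hSS, hR₁, hR₂, hR₁', hR₂', hZZ, hdec⟩ :=
    exists_two_order_decomposition h₁ h₂ hA hB hAB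
  have hFP : Fintype.card F = Fintype.card P := by
    have h := card_eq_of_unitary h₁ h₂
    simp only [Fintype.card_prod, Fintype.card_fin] at h
    exact Nat.eq_of_mul_eq_mul_right (Nat.mul_pos (NeZero.pos d) (NeZero.pos d)) h
  have hP : d * (m + m') = Fintype.card P := by
    have h := congrArg trace hSS
    rw [trace_add, trace_sum, trace_sum, trace_one] at h
    simp only [trace_mul_comm (S _), trace_mul_comm (S' _), hS, hS', if_true, trace_one,
      Fintype.card_fin, Finset.sum_const, Finset.card_univ, nsmul_eq_mul] at h
    rw [mul_add]
    exact_mod_cast h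
  have hcard : Fintype.card (Fin d × Fin (m + m') × Fin 2) = 2 * Fintype.card P := by
    simp only [Fintype.card_prod, Fintype.card_fin, ← hP]
    ring
  obtain ⟨ω₁, hω₁, hω₁', hω₁S⟩ :=
    exists_unitary_eq_on_zero hcard (conjTranspose_stack_mul_stack hSS)
  obtain ⟨ω₃, hω₃, hω₃', hω₃Z⟩ := exists_unitary_eq_on_zero (hFP.symm ▸ hcard)
    (conjTranspose_stack_mul_stack hZZ)
  obtain ⟨hc, hc'⟩ := memorySum_unitary (R := R) (R' := (1 : Matrix (Fin d × Fin m') _ ℂ))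
    hR₁ hR₂ (by simp) (by simp)
  obtain ⟨hb, hb'⟩ := memorySum_unitary (R := (1 : Matrix (Fin d × Fin m) _ ℂ)) (R' := R')
    (by simp) (by simp) hR₁' hR₂'
  refine ⟨m + m', ω₁, _, _, ω₃ᴴ, hω₁, hω₁', hc, hc', hb, hb', by simpa using hω₃',
    by simpa using hω₃, fun f a b p a' b' => ?_⟩
  have h := congrFun₂ (hdec a b a' b') f p
  simp only [block, Matrix.add_apply, Matrix.mul_apply, conjTranspose_apply, submatrix_apply,
    Finset.sum_mul] at h
  simp only [h, hω₁S, hω₃Z, conjTranspose_apply, ← finSumFinEquiv.sum_comp, stack,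
    memorySum, Equiv.symm_apply_apply, Fintype.sum_sum_type, submatrix_apply]
  simp only [Sum.elim_inl, Sum.elim_inr, Equiv.trans_apply, Equiv.prodCongr_apply,
    Prod.map_apply, Equiv.symm_apply_apply, Equiv.prodSumDistrib_apply_left,
    Equiv.prodSumDistrib_apply_right, fromBlocks_apply₁₁, fromBlocks_apply₂₂]
  simp [mul_comm, mul_assoc]

/-- The operation that sends the projection by `Q` of its input to its output ancilla while
sending `T` applied to its input ancilla to its output, and swaps otherwise. -/
noncomputable def controlledSwap {D : Type*} [DecidableEq D] (Q T : Matrix D D ℂ) :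
    Matrix (D × D) (D × D) ℂ :=
  fun o i => Q o.2 i.1 * T o.1 i.2 + (1 - Q) o.2 i.1 * (1 : Matrix D D ℂ) o.1 i.2

theorem controlledSwap_unitary {D : Type*} [Fintype D] [DecidableEq D] {Q T : Matrix D D ℂ}
    (hQ : Q * Q = Q) (hQ' : Qᴴ = Q) (hT : Tᴴ * T = 1) (hT' : T * Tᴴ = 1) :
    (controlledSwap Q T)ᴴ * controlledSwap Q T = 1 ∧
      controlledSwap Q T * (controlledSwap Q T)ᴴ = 1 := by
  have h : controlledSwap Q T =
      (kroneckerMap (· * ·) T Q + kroneckerMap (· * ·) 1 (1 - Q)).submatrix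
        (Equiv.refl (D × D)) (Equiv.prodComm D D) := by
    ext ⟨a, x⟩ ⟨b, y⟩
    simp [controlledSwap, mul_comm]
  have h1 : (1 - Q) * (1 - Q) = 1 - Q := by simp [Matrix.mul_sub, Matrix.sub_mul, hQ]
  have h2 : (1 - Q) * Q = 0 := by simp [Matrix.sub_mul, hQ]
  have h3 : Q * (1 - Q) = 0 := by simp [Matrix.mul_sub, hQ]
  rw [h]
  refine submatrix_unitary ?_ ?_ _ _ <;>
  · rw [conjTranspose_add, conjTranspose_kronecker, conjTranspose_kronecker]
    simp only [Matrix.add_mul, Matrix.mul_add, ← mul_kronecker_mul, hQ', conjTranspose_one,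
      conjTranspose_sub, hQ, h1, h2, h3, hT, hT', kronecker_zero, Matrix.mul_one, add_zero,
      zero_add]
    rw [← kronecker_add, add_sub_cancel, one_kronecker_one]

theorem act_mul_apply {F P D : Type*} [Fintype F] [DecidableEq F] [Fintype P]
    [DecidableEq P] [Fintype D] [DecidableEq D] (W : Matrix (F × D × D) (P × D × D) ℂ)
    (X Y S T : Matrix D D ℂ) (f : F) (p : P) (x y r s : D) :
    (actA (P := F) X * actB (P := F) Y * W * (actA (P := P) S * actB (P := P) T))
        (f, x, y) (p, r, s)
      = ∑ a, ∑ a', ∑ b, ∑ b', X x a * Y y b * W (f, a, b) (p, a', b') * S a' r * T b' s := by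
  have hl : ∀ a b g, (actA (P := F) X * actB (P := F) Y) (f, x, y) (g, a, b)
      = if f = g then X x a * Y y b else 0 := fun a b g => by
    simp only [actA, actB, ← mul_kronecker_mul, kroneckerMap_apply, Matrix.mul_one,
      Matrix.one_mul, one_apply]
    split_ifs <;> simp
  have hr : ∀ a b g, (actA (P := P) S * actB (P := P) T) (g, a, b) (p, r, s)
      = if g = p then S a r * T b s else 0 := fun a b g => by
    simp only [actA, actB, ← mul_kronecker_mul, kroneckerMap_apply, Matrix.mul_one,
      Matrix.one_mul, one_apply]
    split_ifs <;> simp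
  have hl' : ∀ j, (actA (P := F) X * actB (P := F) Y * W) (f, x, y) j
      = ∑ a, ∑ b, X x a * Y y b * W (f, a, b) j := fun j => by
    simp only [Matrix.mul_apply (M := _ * _) (N := W), Fintype.sum_prod_type, hl]
    rw [Finset.sum_eq_single f (fun g _ hg => by simp [hg.symm]) (by simp)]
    simp
  rw [Matrix.mul_apply]
  simp only [Fintype.sum_prod_type, hr, hl']
  rw [Finset.sum_eq_single p (fun g _ hg => by simp [hg]) (by simp)]
  simp only [if_true, Finset.sum_mul]
  calc _ = ∑ a', ∑ a, ∑ b', ∑ b,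
        X x a * Y y b * W (f, a, b) (p, a', b') * (S a' r * T b' s) :=
        Finset.sum_congr rfl fun _ _ => Finset.sum_comm
    _ = ∑ a, ∑ a', ∑ b', ∑ b,
        X x a * Y y b * W (f, a, b) (p, a', b') * (S a' r * T b' s) := Finset.sum_comm
    _ = _ := Finset.sum_congr rfl fun _ _ => Finset.sum_congr rfl fun _ _ => by
        rw [Finset.sum_comm]
        exact Finset.sum_congr rfl fun _ _ => Finset.sum_congr rfl fun _ _ => by ring

theorem controlledLoop_apply {F P D : Type*} [Fintype F] [DecidableEq F] [Fintype P]
    [DecidableEq P] [Fintype D] [DecidableEq D] (W : Matrix (F × D × D) (P × D × D) ℂ)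
    (Q Q' S T : Matrix D D ℂ) (f : F) (p : P) (x y r s : D) :
    controlledLoop W Q Q' S T (f, x, y) (p, r, s)
      = ∑ a, ∑ a', ∑ b, ∑ b', controlledSwap Q S (a', x) (a, r) *
          controlledSwap Q' T (b', y) (b, s) * W (f, a, b) (p, a', b') := by
  have h : controlledLoop W Q Q' S T =
      actA (P := F) Q * actB (P := F) Q' * W * (actA (P := P) S * actB (P := P) T)
      + actA (P := F) Q * actB (P := F) (1 - Q') * W * (actA (P := P) S * actB (P := P) 1)
      + actA (P := F) (1 - Q) * actB (P := F) Q' * W * (actA (P := P) 1 * actB (P := P) T)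
      + actA (P := F) (1 - Q) * actB (P := F) (1 - Q') * W *
        (actA (P := P) (1 : Matrix D D ℂ) * actB (P := P) (1 : Matrix D D ℂ)) := by
    simp only [controlledLoop, actA_one, actB_one, Matrix.mul_one, Matrix.one_mul]
  rw [h, Matrix.add_apply, Matrix.add_apply, Matrix.add_apply, act_mul_apply, act_mul_apply,
    act_mul_apply, act_mul_apply]
  simp only [← Finset.sum_add_distrib]
  refine Finset.sum_congr rfl fun _ _ => Finset.sum_congr rfl fun _ _ =>
    Finset.sum_congr rfl fun _ _ => Finset.sum_congr rfl fun _ _ => ?_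
  simp only [controlledSwap]
  ring

theorem controlledLoop_one {F P D : Type*} [Fintype F] [DecidableEq F] [Fintype P]
    [DecidableEq P] [Fintype D] [DecidableEq D] (W : Matrix (F × D × D) (P × D × D) ℂ) :
    controlledLoop W 1 1 1 1 = W := by
  simp [controlledLoop, actA, actB]

/-- The bipartite operator obtained from a tripartite one by inserting the operation `V` at
the third site. -/
noncomputable def insertThird {d : ℕ} {F P C : Type*}
    (U : Matrix (F × Fin d × Fin d × Fin d) (P × Fin d × Fin d × Fin d) ℂ)
    (V : Matrix (Fin d × C) (Fin d × C) ℂ) :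
    Matrix ((C × F) × Fin d × Fin d) ((C × P) × Fin d × Fin d) ℂ :=
  fun o i => ∑ ci, ∑ co, U (o.1.2, o.2.1, o.2.2, ci) (i.1.2, i.2.1, i.2.2, co) *
    V (co, o.1.1) (ci, i.1.1)

/-- Moves the leading factor to the end. -/
def thirdLast (C X : Type*) (d : ℕ) : (C × X) × Fin d × Fin d ≃ X × Fin d × Fin d × C where
  toFun i := (i.1.2, i.2.1, i.2.2, i.1.1)
  invFun i := ((i.2.2.2, i.1), i.2.1, i.2.2.1)
  left_inv _ := rfl
  right_inv _ := rfl

theorem controlledLoop_insertThird_unitary {d : ℕ} {F P C : Type*} [Fintype F]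
    [DecidableEq F] [Fintype P] [DecidableEq P] [Fintype C] [DecidableEq C]
    {U : Matrix (F × Fin d × Fin d × Fin d) (P × Fin d × Fin d × Fin d) ℂ}
    {UC : Matrix (Fin d × C) (Fin d × C) ℂ}
    (hRev : ∀ UA UB : Matrix (Fin d × Fin d) (Fin d × Fin d) ℂ,
      UAᴴ * UA = 1 → UA * UAᴴ = 1 → UBᴴ * UB = 1 → UB * UBᴴ = 1 →
      ∃ V : Matrix (F × Fin d × Fin d × C) (P × Fin d × Fin d × C) ℂ,
        Vᴴ * V = 1 ∧ V * Vᴴ = 1 ∧ ∀ p ai' bi' ci' f ao' bo' co',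
          V (f, ao', bo', co') (p, ai', bi', ci') =
            ∑ ai : Fin d, ∑ ao : Fin d, ∑ bi : Fin d, ∑ bo : Fin d,
              ∑ ci : Fin d, ∑ co : Fin d,
              U (f, ai, bi, ci) (p, ao, bo, co) * UA (ao, ao') (ai, ai')
                * UB (bo, bo') (bi, bi') * UC (co, co') (ci, ci'))
    {Q Q' S T : Matrix (Fin d) (Fin d) ℂ} (hQ : Q * Q = Q) (hQ' : Qᴴ = Q)
    (hR : Q' * Q' = Q') (hR' : Q'ᴴ = Q') (hS : Sᴴ * S = 1) (hS' : S * Sᴴ = 1)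
    (hT : Tᴴ * T = 1) (hT' : T * Tᴴ = 1) :
    (controlledLoop (insertThird U UC) Q Q' S T)ᴴ *
        controlledLoop (insertThird U UC) Q Q' S T = 1 ∧
      controlledLoop (insertThird U UC) Q Q' S T *
        (controlledLoop (insertThird U UC) Q Q' S T)ᴴ = 1 := by
  obtain ⟨hA, hA'⟩ := controlledSwap_unitary hQ hQ' hS hS'
  obtain ⟨hB, hB'⟩ := controlledSwap_unitary hR hR' hT hT'
  obtain ⟨V, h₁, h₂, hV⟩ := hRev _ _ hA hA' hB hB'
  have h : controlledLoop (insertThird U UC) Q Q' S T =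
      V.submatrix (thirdLast C F d) (thirdLast C P d) := by
    ext ⟨⟨co', f⟩, x, y⟩ ⟨⟨ci', p⟩, r, s⟩
    rw [controlledLoop_apply, submatrix_apply]
    refine Eq.trans ?_ (hV p r s ci' f x y co').symm
    refine Finset.sum_congr rfl fun _ _ => Finset.sum_congr rfl fun _ _ =>
      Finset.sum_congr rfl fun _ _ => Finset.sum_congr rfl fun _ _ => ?_
    rw [insertThird, Finset.mul_sum]
    refine Finset.sum_congr rfl fun _ _ => ?_
    rw [Finset.mul_sum]
    exact Finset.sum_congr rfl fun _ _ => by ring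
  rw [h]
  exact submatrix_unitary h₁ h₂ _ _

theorem exists_tripartite_temporal_circuit {d : ℕ} [NeZero d] {pO fI cI' cO' : Type}
    [Fintype pO] [DecidableEq pO] [Fintype fI] [DecidableEq fI] [Fintype cI'] [DecidableEq cI']
    [Fintype cO'] [DecidableEq cO']
    {U : Matrix (fI × Fin d × Fin d × Fin d) (pO × Fin d × Fin d × Fin d) ℂ}
    {UC : Matrix (Fin d × cO') (Fin d × cI') ℂ} (hUC : UCᴴ * UC = 1) (hUC' : UC * UCᴴ = 1)
    (hRev : ∀ UA UB : Matrix (Fin d × Fin d) (Fin d × Fin d) ℂ,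
      ∀ UC : Matrix (Fin d × cI') (Fin d × cI') ℂ,
      UAᴴ * UA = 1 → UA * UAᴴ = 1 → UBᴴ * UB = 1 → UB * UBᴴ = 1 →
      UCᴴ * UC = 1 → UC * UCᴴ = 1 →
      ∃ V : Matrix (fI × Fin d × Fin d × cI') (pO × Fin d × Fin d × cI') ℂ,
        Vᴴ * V = 1 ∧ V * Vᴴ = 1 ∧ ∀ p ai' bi' ci' f ao' bo' co',
          V (f, ao', bo', co') (p, ai', bi', ci') =
            ∑ ai : Fin d, ∑ ao : Fin d, ∑ bi : Fin d, ∑ bo : Fin d,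
              ∑ ci : Fin d, ∑ co : Fin d,
              U (f, ai, bi, ci) (p, ao, bo, co) * UA (ao, ao') (ai, ai')
                * UB (bo, bo') (bi, bi') * UC (co, co') (ci, ci')) :
    ∃ (n : ℕ) (ω₁ : Matrix (Fin d × Fin n × Fin 2) (Fin 2 × cI' × pO) ℂ)
      (ω₂c ω₂b : Matrix (Fin d × Fin n) (Fin d × Fin n) ℂ)
      (ω₃ : Matrix (Fin 2 × cO' × fI) (Fin d × Fin n × Fin 2) ℂ),
      ω₁ᴴ * ω₁ = 1 ∧ ω₁ * ω₁ᴴ = 1 ∧ ω₂cᴴ * ω₂c = 1 ∧ ω₂c * ω₂cᴴ = 1 ∧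
      ω₂bᴴ * ω₂b = 1 ∧ ω₂b * ω₂bᴴ = 1 ∧ ω₃ᴴ * ω₃ = 1 ∧ ω₃ * ω₃ᴴ = 1 ∧
      ∀ p ao bo ci' f ai bi co',
        (∑ x, ∑ y, ω₁ (ai, x, 0) (0, ci', p) * ω₂c (bi, y) (ao, x) * ω₃ (0, co', f) (bo, y, 0))
          + ∑ x, ∑ y, ω₁ (bi, x, 1) (0, ci', p) * ω₂b (ai, y) (bo, x) * ω₃ (0, co', f) (ao, y, 1)
        = ∑ ci, ∑ co, U (f, ai, bi, ci) (p, ao, bo, co) * UC (co, co') (ci, ci') := by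
  have hcard : Fintype.card cO' = Fintype.card cI' := by
    have h := card_eq_of_unitary hUC hUC'
    simp only [Fintype.card_prod, Fintype.card_fin] at h
    exact Nat.eq_of_mul_eq_mul_left (Nat.pos_of_neZero d) h
  let e : cO' ≃ cI' := Fintype.equivOfCardEq hcard
  obtain ⟨hS, hS'⟩ := submatrix_unitary hUC hUC' (Equiv.prodCongr (Equiv.refl (Fin d)) e.symm)
    (Equiv.refl (Fin d × cI'))
  set UC' := UC.submatrix (Equiv.prodCongr (Equiv.refl (Fin d)) e.symm)
    (Equiv.refl (Fin d × cI'))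
  have hloop : ∀ Q Q' S T : Matrix (Fin d) (Fin d) ℂ, Q * Q = Q → Qᴴ = Q → Q' * Q' = Q' →
      Q'ᴴ = Q' → Sᴴ * S = 1 → S * Sᴴ = 1 → Tᴴ * T = 1 → T * Tᴴ = 1 →
      (controlledLoop (insertThird U UC') Q Q' S T)ᴴ *
        controlledLoop (insertThird U UC') Q Q' S T = 1 ∧
      controlledLoop (insertThird U UC') Q Q' S T *
        (controlledLoop (insertThird U UC') Q Q' S T)ᴴ = 1 := fun _ _ _ _ a b c d e f g h =>
    controlledLoop_insertThird_unitary
      (fun UA UB hA hA' hB hB' => hRev UA UB UC' hA hA' hB hB' hS hS') a b c d e f g h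
  have h1 : (1 : Matrix (Fin d) (Fin d) ℂ)ᴴ = 1 := conjTranspose_one
  obtain ⟨hW, hW'⟩ := hloop 1 1 1 1 (by simp) h1 (by simp) h1 (by simp) (by simp) (by simp)
    (by simp)
  rw [controlledLoop_one] at hW hW'
  obtain ⟨n, ω₁, ω₂c, ω₂b, ω₃, u1, u2, u3, u4, u5, u6, u7, u8, h⟩ :=
    exists_temporal_circuit hW hW' fun _ _ _ _ a b c d e f g h => (hloop _ _ _ _ a b c d e f g h).1
  obtain ⟨v1, v2⟩ := submatrix_unitary u7 u8
    (Equiv.prodCongr (Equiv.refl (Fin 2)) (Equiv.prodCongr e (Equiv.refl fI)))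
    (Equiv.refl (Fin d × Fin n × Fin 2))
  refine ⟨n, ω₁, ω₂c, ω₂b, _, u1, u2, u3, u4, u5, u6, v1, v2, fun p ao bo ci' f ai bi co' => ?_⟩
  refine (h (e co', f) ai bi (ci', p) ao bo).symm.trans ?_
  simp [insertThird, UC']

/-- The change of subsystems at the ends of the circuit: depending on the qubit, the two target
systems are identified with the input systems of the first and second party in either order. -/
def route {d : ℕ} {P Z : Type*} (z : Fin d × P ≃ Z) :
    Fin d × Fin d × Fin d × Fin 2 × Z ≃ Fin d × Fin d × Fin d × Fin d × Fin 2 × P where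
  toFun i := (if i.2.2.2.1 = 0 then i.1 else i.2.1, if i.2.2.2.1 = 0 then i.2.1 else i.1, i.2.2.1,
    (z.symm i.2.2.2.2).1, i.2.2.2.1, (z.symm i.2.2.2.2).2)
  invFun o := (if o.2.2.2.2.1 = 0 then o.1 else o.2.1, if o.2.2.2.2.1 = 0 then o.2.1 else o.1,
    o.2.2.1, o.2.2.2.2.1, z (o.2.2.2.1, o.2.2.2.2.2))
  left_inv := by
    rintro ⟨a, b, c, y, x⟩
    by_cases hy : y = 0 <;> simp [hy]
  right_inv := by
    rintro ⟨t₁, t₂, t₃, t₄, y, p⟩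
    by_cases hy : y = 0 <;> simp [hy]

/-- The unitary matrix of `route`. -/
noncomputable def routing {d : ℕ} {P Z : Type*} [DecidableEq P] (z : Fin d × P ≃ Z) :
    Matrix (Fin d × Fin d × Fin d × Fin d × Fin 2 × P) (Fin d × Fin d × Fin d × Fin 2 × Z) ℂ :=
  (1 : Matrix _ _ ℂ).submatrix (Equiv.refl _) (route z)

theorem routing_unitary {d : ℕ} {P Z : Type*} [Fintype P] [DecidableEq P] [Fintype Z]
    [DecidableEq Z] (z : Fin d × P ≃ Z) :
    (routing z)ᴴ * routing z = 1 ∧ routing z * (routing z)ᴴ = 1 :=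
  submatrix_unitary (by simp) (by simp) _ _

theorem Phi1_eq {d : ℕ} {pO fI cI' cO' A' B' E₁ E₂ : Type*}
    [Fintype E₁] [Fintype E₂] [Fintype A'] [Fintype B'] [DecidableEq A'] [DecidableEq B']
    (ω₁ : Matrix (Fin d × E₁ × Fin 2) (Fin 2 × cI' × pO) ℂ)
    (ω₂c ω₂b : Matrix (Fin d × E₂) (Fin d × E₁) ℂ)
    (ω₃ : Matrix (Fin 2 × cO' × fI) (Fin d × E₂ × Fin 2) ℂ)
    (UA : Matrix (Fin d × A') (Fin d × A') ℂ) (UB : Matrix (Fin d × B') (Fin d × B') ℂ)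
    (ci' : cI') (p : pO) (ai bi tb1' tb2' : Fin d) (y qb2' : Fin 2) (ai' : A') (bi' : B')
    (tb1 tb2 ao bo : Fin d) (qb1 ybar : Fin 2) (co' : cO') (f : fI) (ao' : A') (bo' : B') :
    Phi1 ω₁ ω₂c ω₂b ω₃ UA UB ci' p (if y = 0 then ai else bi) (if y = 0 then bi else ai) tb1' tb2'
        y qb2' ai' bi' tb1 tb2 (if ybar = 0 then ao else bo) (if ybar = 0 then bo else ao) qb1 ybar
        co' f ao' bo' =
      UA (ao, ao') (ai, ai') * UB (bo, bo') (bi, bi') *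
        if y = ybar then ∑ e1, ∑ e2, ω₁ (tb1, e1, qb1) (0, ci', p) *
          (if y = 0 then ω₂c else ω₂b) (tb2, e2) (tb1', e1) * ω₃ (0, co', f) (tb2', e2, qb2')
        else 0 := by
  fin_cases y <;> fin_cases ybar <;>
    simp [Phi1, gate1, gate2, Finset.mul_sum]
  · exact Finset.sum_congr rfl fun _ _ => Finset.sum_congr rfl fun _ _ => by ring
  · exact Finset.sum_congr rfl fun _ _ => Finset.sum_congr rfl fun _ _ => by ring

/-- The operation of the remaining party in the delocalised description of the circuit. -/
noncomputable def remainder {d : ℕ} {pO fI cI' cO' E₁ E₂ Z : Type*} [Fintype E₁] [Fintype E₂]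
    (ω₁ : Matrix (Fin d × E₁ × Fin 2) (Fin 2 × cI' × pO) ℂ)
    (ω₂c ω₂b : Matrix (Fin d × E₂) (Fin d × E₁) ℂ)
    (ω₃ : Matrix (Fin 2 × cO' × fI) (Fin d × E₂ × Fin 2) ℂ)
    (zin : Fin d × pO ≃ Z) (zout : Fin d × fI ≃ Z) :
    Matrix (cO' × Fin d × Fin 2 × Z × Fin 2) (cI' × Fin d × Fin 2 × Z × Fin 2) ℂ :=
  fun o i => if i.2.2.1 = o.2.2.1 then
    ∑ e1, ∑ e2, ω₁ (o.2.1, e1, o.2.2.2.2) (0, i.1, (zin.symm i.2.2.2.1).2) *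
      (if i.2.2.1 = 0 then ω₂c else ω₂b) ((zout.symm o.2.2.2.1).1, e2) (i.2.1, e1) *
      ω₃ (0, o.1, (zout.symm o.2.2.2.1).2) ((zin.symm i.2.2.2.1).1, e2, i.2.2.2.2)
    else 0

theorem delocalised_factorisation {d : ℕ} {pO fI cI' cO' A' B' E₁ E₂ Z : Type*}
    [Fintype pO] [DecidableEq pO] [Fintype fI] [DecidableEq fI] [DecidableEq Z]
    [Fintype E₁] [Fintype E₂] [Fintype A'] [Fintype B'] [DecidableEq A'] [DecidableEq B']
    (ω₁ : Matrix (Fin d × E₁ × Fin 2) (Fin 2 × cI' × pO) ℂ)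
    (ω₂c ω₂b : Matrix (Fin d × E₂) (Fin d × E₁) ℂ)
    (ω₃ : Matrix (Fin 2 × cO' × fI) (Fin d × E₂ × Fin 2) ℂ)
    (zin : Fin d × pO ≃ Z) (zout : Fin d × fI ≃ Z)
    (UA : Matrix (Fin d × A') (Fin d × A') ℂ) (UB : Matrix (Fin d × B') (Fin d × B') ℂ)
    (ai bi ci : Fin d) (y : Fin 2) (z : Z) (ci' : cI') (qb2' : Fin 2) (ai' : A') (bi' : B')
    (ao bo co : Fin d) (ybar : Fin 2) (zbar : Z) (qb1 : Fin 2) (co' : cO') (ao' : A') (bo' : B') :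
    (∑ t1 : Fin d, ∑ t2 : Fin d, ∑ tb1' : Fin d, ∑ tb2' : Fin d, ∑ q1 : Fin 2, ∑ p : pO,
      ∑ tb1 : Fin d, ∑ tb2 : Fin d, ∑ t1' : Fin d, ∑ t2' : Fin d, ∑ q2' : Fin 2, ∑ f : fI,
        routing zin (t1, t2, tb1', tb2', q1, p) (ai, bi, ci, y, z)
          * Phi1 ω₁ ω₂c ω₂b ω₃ UA UB ci' p t1 t2 tb1' tb2' q1 qb2'
              ai' bi' tb1 tb2 t1' t2' qb1 q2' co' f ao' bo'
          * (routing zout)ᴴ (ao, bo, co, ybar, zbar) (t1', t2', tb1, tb2, q2', f))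
      = UA (ao, ao') (ai, ai') * UB (bo, bo') (bi, bi')
          * remainder ω₁ ω₂c ω₂b ω₃ zin zout (co', co, ybar, zbar, qb1) (ci', ci, y, z, qb2') := by
  simp only [routing, conjTranspose_apply, submatrix_apply, Equiv.refl_apply, one_apply, route,
    Equiv.coe_fn_mk, Prod.mk.injEq, apply_ite star, star_one, star_zero, ite_and, ite_mul,
    one_mul, zero_mul, mul_ite, mul_one, mul_zero, Finset.sum_ite_eq', Finset.mem_univ, if_true,
    Finset.sum_const_zero, Finset.sum_ite_irrel]
  rw [Phi1_eq]
  rfl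

theorem remainder_link {d : ℕ} {pO fI cI' cO' E₁ E₂ Z : Type*}
    [Fintype pO] [DecidableEq pO] [Fintype fI] [DecidableEq fI] [DecidableEq Z] [Fintype Z]
    [Fintype E₁] [Fintype E₂]
    (ω₁ : Matrix (Fin d × E₁ × Fin 2) (Fin 2 × cI' × pO) ℂ)
    (ω₂c ω₂b : Matrix (Fin d × E₂) (Fin d × E₁) ℂ)
    (ω₃ : Matrix (Fin 2 × cO' × fI) (Fin d × E₂ × Fin 2) ℂ)
    (zin : Fin d × pO ≃ Z) (zout : Fin d × fI ≃ Z)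
    (p : pO) (ao bo : Fin d) (ci' : cI') (f : fI) (ai bi : Fin d) (co' : cO') :
    (∑ ci : Fin d, ∑ co : Fin d, ∑ y : Fin 2, ∑ ybar : Fin 2, ∑ z : Z, ∑ zbar : Z,
      ∑ qb1 : Fin 2, ∑ qb2' : Fin 2,
        remainder ω₁ ω₂c ω₂b ω₃ zin zout (co', co, ybar, zbar, qb1) (ci', ci, y, z, qb2') *
          ∑ t1 : Fin d, ∑ t2 : Fin d, ∑ t3 : Fin d, ∑ t4 : Fin d,
            star ((routing zout)ᴴ (ao, bo, co, ybar, zbar) (t3, t4, t1, t2, qb2', f)) *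
              star (routing zin (t1, t2, t3, t4, qb1, p) (ai, bi, ci, y, z)))
      = (∑ x, ∑ y, ω₁ (ai, x, 0) (0, ci', p) * ω₂c (bi, y) (ao, x) * ω₃ (0, co', f) (bo, y, 0))
        + ∑ x, ∑ y, ω₁ (bi, x, 1) (0, ci', p) * ω₂b (ai, y) (bo, x)
          * ω₃ (0, co', f) (ao, y, 1) := by
  have h : ∀ (ci co : Fin d) (y ybar : Fin 2) (z zbar : Z) (qb1 qb2' : Fin 2),
      (∑ t1 : Fin d, ∑ t2 : Fin d, ∑ t3 : Fin d, ∑ t4 : Fin d,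
        star ((routing zout)ᴴ (ao, bo, co, ybar, zbar) (t3, t4, t1, t2, qb2', f)) *
          star (routing zin (t1, t2, t3, t4, qb1, p) (ai, bi, ci, y, z)))
      = if ci = (if ybar = 0 then ao else bo) then if co = (if y = 0 then ai else bi) then
          if z = zin (if ybar = 0 then bo else ao, p) then
          if zbar = zout (if y = 0 then bi else ai, f) then
          if qb1 = y then if qb2' = ybar then 1 else 0 else 0 else 0 else 0 else 0 else 0 := by
    intro ci co y ybar z zbar qb1 qb2'
    obtain ⟨⟨zt, zp⟩, rfl⟩ := zin.surjective z
    obtain ⟨⟨wt, wf⟩, rfl⟩ := zout.surjective zbar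
    simp only [routing, conjTranspose_apply, submatrix_apply, Equiv.refl_apply, one_apply,
      route, Equiv.coe_fn_mk, Prod.mk.injEq, Equiv.symm_apply_apply, EmbeddingLike.apply_eq_iff_eq,
      apply_ite star, star_one, star_zero]
    simp only [ite_and, mul_ite, mul_one, mul_zero, Finset.sum_ite_eq', Finset.mem_univ, if_true,
      Finset.sum_const_zero, Finset.sum_ite_irrel]
    grind
  simp only [h, Fin.sum_univ_two, remainder]
  simp [Finset.sum_add_distrib]

/-- Proposition 2. Let
`U : H^{P_O} ⊗ H^{A_O} ⊗ H^{B_O} ⊗ H^{C_O} → H^{F_I} ⊗ H^{A_I} ⊗ H^{B_I} ⊗ H^{C_I}` be a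
unitary extension of a tripartite process with `dim H^{X_I} = dim H^{X_O} = d` for
`X = A, B, C` (all these systems being modelled by the index type `Fin d`, their fixed
computational bases providing the canonical identifications used in the construction).
Then for every choice of ancillas `H^{C_I'}`, `H^{C_O'}` and every unitary
`U_C : H^{C_I} ⊗ H^{C_I'} → H^{C_O} ⊗ H^{C_O'}` there exist circuit ancillas
`H^{E₁} = Fin n₁`, `H^{E₂} = Fin n₂`, a memory system `H^Z ≅ H^{Z̄} = Fin nz` (the
two-dimensional systems `H^{Q...}`, `H^Y ≅ H^{Ȳ}`, `H^p`, `H^f` being `Fin 2`), unitaries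
`ω₁(U_C)`, `ω₂°(U_C)`, `ω₂•(U_C)`, `ω₃(U_C)`, unitary isomorphisms `J_in`, `J_out`, and a
linear map `R(U_C) : H^{C_I'} ⊗ H^{C_I} ⊗ H^Y ⊗ H^Z ⊗ H^{Q̄₂'} →
H^{C_O'} ⊗ H^{C_O} ⊗ H^{Ȳ} ⊗ H^{Z̄} ⊗ H^{Q̄₁}` such that, for all unitaries `U_A`, `U_B`
(with ancillas `H^{A_I'} = H^{A_O'} = A'` and `H^{B_I'} = H^{B_O'} = B'`),
`|J_in⟩⟩ * |Φ₁(U_A,U_B,U_C)⟩⟩ * |J_out⟩⟩ = |U_A⟩⟩ ⊗ |U_B⟩⟩ ⊗ |R(U_C)⟩⟩`, and moreover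
`|R(U_C)⟩⟩ * |R'⟩⟩ = |U⟩⟩ * |U_C⟩⟩`, where `R'` (Eq. (C24)) is obtained by composing
`J_out†` and `J_in†` with the identity channels relating the barred and unbarred target
and control systems, and the right-hand link product contracts `C_I, C_O`.
In particular, with respect to the time-delocalised subsystems defined by `J_in` and
`J_out`, the temporal circuit consists of `U_A`, `U_B`, `U_C` and `U` composed in a
cyclic circuit as in the process matrix framework. -/
theorem unitary_extension_tripartite_time_delocalised
    (d : ℕ) (pO fI : Type)
    [Fintype pO] [DecidableEq pO] [Fintype fI] [DecidableEq fI]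
    (U : Matrix (fI × Fin d × Fin d × Fin d) (pO × Fin d × Fin d × Fin d) ℂ)
    (hU₁ : Uᴴ * U = 1) (hU₂ : U * Uᴴ = 1)
    (hRev : ∀ (A' B' C' : Type)
      [Fintype A'] [DecidableEq A'] [Fintype B'] [DecidableEq B']
      [Fintype C'] [DecidableEq C'],
      ∀ (UA : Matrix (Fin d × A') (Fin d × A') ℂ)
        (UB : Matrix (Fin d × B') (Fin d × B') ℂ)
        (UC : Matrix (Fin d × C') (Fin d × C') ℂ),
        UAᴴ * UA = 1 → UA * UAᴴ = 1 → UBᴴ * UB = 1 → UB * UBᴴ = 1 →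
        UCᴴ * UC = 1 → UC * UCᴴ = 1 →
        ∃ V : Matrix (fI × A' × B' × C') (pO × A' × B' × C') ℂ,
          Vᴴ * V = 1 ∧ V * Vᴴ = 1 ∧
          ∀ (p : pO) (ai' : A') (bi' : B') (ci' : C')
            (f : fI) (ao' : A') (bo' : B') (co' : C'),
            V (f, ao', bo', co') (p, ai', bi', ci') =
              ∑ ai : Fin d, ∑ ao : Fin d, ∑ bi : Fin d, ∑ bo : Fin d,
                ∑ ci : Fin d, ∑ co : Fin d,
                U (f, ai, bi, ci) (p, ao, bo, co) * UA (ao, ao') (ai, ai')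
                  * UB (bo, bo') (bi, bi') * UC (co, co') (ci, ci')) :
    ∀ (cI' cO' : Type) [Fintype cI'] [DecidableEq cI'] [Fintype cO'] [DecidableEq cO'],
    ∀ UC : Matrix (Fin d × cO') (Fin d × cI') ℂ,
      UCᴴ * UC = 1 → UC * UCᴴ = 1 →
      ∃ (n₁ n₂ nz : ℕ)
        (ω₁ : Matrix (Fin d × Fin n₁ × Fin 2) (Fin 2 × cI' × pO) ℂ)
        (ω₂c : Matrix (Fin d × Fin n₂) (Fin d × Fin n₁) ℂ)
        (ω₂b : Matrix (Fin d × Fin n₂) (Fin d × Fin n₁) ℂ)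
        (ω₃ : Matrix (Fin 2 × cO' × fI) (Fin d × Fin n₂ × Fin 2) ℂ)
        (Jin : Matrix (Fin d × Fin d × Fin d × Fin d × Fin 2 × pO)
          (Fin d × Fin d × Fin d × Fin 2 × Fin nz) ℂ)
        (Jout : Matrix (Fin d × Fin d × Fin d × Fin 2 × Fin nz)
          (Fin d × Fin d × Fin d × Fin d × Fin 2 × fI) ℂ)
        (R : Matrix (cO' × Fin d × Fin 2 × Fin nz × Fin 2)
          (cI' × Fin d × Fin 2 × Fin nz × Fin 2) ℂ),
        ω₁ᴴ * ω₁ = 1 ∧ ω₁ * ω₁ᴴ = 1 ∧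
        ω₂cᴴ * ω₂c = 1 ∧ ω₂c * ω₂cᴴ = 1 ∧
        ω₂bᴴ * ω₂b = 1 ∧ ω₂b * ω₂bᴴ = 1 ∧
        ω₃ᴴ * ω₃ = 1 ∧ ω₃ * ω₃ᴴ = 1 ∧
        Jinᴴ * Jin = 1 ∧ Jin * Jinᴴ = 1 ∧
        Joutᴴ * Jout = 1 ∧ Jout * Joutᴴ = 1 ∧
        -- `|J_in⟩⟩ * |Φ₁(U_A,U_B,U_C)⟩⟩ * |J_out⟩⟩ = |U_A⟩⟩ ⊗ |U_B⟩⟩ ⊗ |R(U_C)⟩⟩`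
        (∀ (A' B' : Type)
          [Fintype A'] [DecidableEq A'] [Fintype B'] [DecidableEq B'],
          ∀ (UA : Matrix (Fin d × A') (Fin d × A') ℂ)
            (UB : Matrix (Fin d × B') (Fin d × B') ℂ),
            UAᴴ * UA = 1 → UA * UAᴴ = 1 → UBᴴ * UB = 1 → UB * UBᴴ = 1 →
            ∀ (ai bi ci : Fin d) (y : Fin 2) (z : Fin nz)
              (ci' : cI') (qb2' : Fin 2) (ai' : A') (bi' : B')
              (ao bo co : Fin d) (ybar : Fin 2) (zbar : Fin nz)
              (qb1 : Fin 2) (co' : cO') (ao' : A') (bo' : B'),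
              (∑ t1 : Fin d, ∑ t2 : Fin d, ∑ tb1' : Fin d, ∑ tb2' : Fin d,
                ∑ q1 : Fin 2, ∑ p : pO,
                ∑ tb1 : Fin d, ∑ tb2 : Fin d, ∑ t1' : Fin d, ∑ t2' : Fin d,
                ∑ q2' : Fin 2, ∑ f : fI,
                  Jin (t1, t2, tb1', tb2', q1, p) (ai, bi, ci, y, z)
                    * Phi1 ω₁ ω₂c ω₂b ω₃ UA UB ci' p t1 t2 tb1' tb2' q1 qb2'
                        ai' bi' tb1 tb2 t1' t2' qb1 q2' co' f ao' bo'
                    * Jout (ao, bo, co, ybar, zbar) (t1', t2', tb1, tb2, q2', f))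
                = UA (ao, ao') (ai, ai') * UB (bo, bo') (bi, bi')
                    * R (co', co, ybar, zbar, qb1) (ci', ci, y, z, qb2')) ∧
        -- `|R(U_C)⟩⟩ * |R'⟩⟩ = |U⟩⟩ * |U_C⟩⟩`, with `R'` written out via `J_out†`,
        -- `J_in†` and the identity channels relating barred and unbarred systems
        (∀ (p : pO) (ao bo : Fin d) (ci' : cI') (f : fI) (ai bi : Fin d) (co' : cO'),
          (∑ ci : Fin d, ∑ co : Fin d, ∑ y : Fin 2, ∑ ybar : Fin 2,
            ∑ z : Fin nz, ∑ zbar : Fin nz, ∑ qb1 : Fin 2, ∑ qb2' : Fin 2,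
              R (co', co, ybar, zbar, qb1) (ci', ci, y, z, qb2')
                * (∑ t1 : Fin d, ∑ t2 : Fin d, ∑ t3 : Fin d, ∑ t4 : Fin d,
                    star (Jout (ao, bo, co, ybar, zbar) (t3, t4, t1, t2, qb2', f))
                      * star (Jin (t1, t2, t3, t4, qb1, p) (ai, bi, ci, y, z))))
            = ∑ ci : Fin d, ∑ co : Fin d,
                U (f, ai, bi, ci) (p, ao, bo, co) * UC (co, co') (ci, ci')) := by
  rcases Nat.eq_zero_or_pos d with rfl | hd
  · intro cI' cO' _ _ _ _ UC _ _
    obtain ⟨V, hV₁, hV₂, hV⟩ := hRev Unit Unit Unit 1 1 1 (by simp) (by simp) (by simp) (by simp)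
      (by simp) (by simp)
    have hV0 : V = 0 := by
      ext ⟨f, -, -, -⟩ ⟨p, -, -, -⟩
      simp [hV]
    subst hV0
    have : IsEmpty pO := ⟨fun p => by simpa using congrFun₂ hV₁ (p, (), (), ()) (p, (), (), ())⟩
    have : IsEmpty fI := ⟨fun f => by simpa using congrFun₂ hV₂ (f, (), (), ()) (f, (), (), ())⟩
    exact ⟨0, 0, 0, 0, 0, 0, 0, 0, 0, 0, Subsingleton.elim _ _, Subsingleton.elim _ _,
      Subsingleton.elim _ _, Subsingleton.elim _ _, Subsingleton.elim _ _, Subsingleton.elim _ _,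
      Subsingleton.elim _ _, Subsingleton.elim _ _, Subsingleton.elim _ _, Subsingleton.elim _ _,
      Subsingleton.elim _ _, Subsingleton.elim _ _,
      fun A' B' _ _ _ _ UA UB _ _ _ _ ai => ai.elim0, fun _ ao => ao.elim0⟩
  · intro cI' cO' _ _ _ _ UC hUC hUC'
    have : NeZero d := ⟨hd.ne'⟩
    obtain ⟨n, ω₁, ω₂c, ω₂b, ω₃, u₁, u₂, u₃, u₄, u₅, u₆, u₇, u₈, h⟩ :=
      exists_tripartite_temporal_circuit hUC hUC' (hRev (Fin d) (Fin d) cI')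
    have hcard : Fintype.card (Fin d × fI) = Fintype.card (Fin d × pO) := by
      have h := card_eq_of_unitary hU₁ hU₂
      simp only [Fintype.card_prod, Fintype.card_fin] at h ⊢
      rw [Nat.eq_of_mul_eq_mul_right (Nat.mul_pos hd (Nat.mul_pos hd hd)) h]
    let zin := Fintype.equivFin (Fin d × pO)
    let zout := Fintype.equivFinOfCardEq hcard
    obtain ⟨hin, hin'⟩ := routing_unitary zin
    obtain ⟨hout, hout'⟩ := routing_unitary zout
    refine ⟨n, n, _, ω₁, ω₂c, ω₂b, ω₃, routing zin, (routing zout)ᴴ,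
      remainder ω₁ ω₂c ω₂b ω₃ zin zout, u₁, u₂, u₃, u₄, u₅, u₆, u₇, u₈, hin, hin',
      by rwa [conjTranspose_conjTranspose], by rwa [conjTranspose_conjTranspose], ?_, ?_⟩
    · intro A' B' _ _ _ _ UA UB _ _ _ _
      exact delocalised_factorisation ω₁ ω₂c ω₂b ω₃ zin zout UA UB
    · intro p ao bo ci' f ai bi co'
      rw [remainder_link, h]
end
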